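/- arXiv:1901.05260 — 8 statements merged into one kernel-verified Lean document; each statement's English description precedes it below -/
import Mathlib

section
/- Consider the consensus-ADMM iteration under the following assumptions: L_α > 0, L > 0; h ≥ 0 and h satisfies the joint descent inequality h(α',Φ') ≤ h(α,Φ) + ∂_αh(α,Φ)·(α'−α) + ⟨∇_Φh(α,Φ), Φ'−Φ⟩ + (L_α/2)(α'−α)² + (L/2)‖Φ'−Φ‖² for all (α,Φ), (α',Φ'); for every n ∈ T, f_n ≥ 0, f_n has L_n-Lipschitz gradient with L_n > 0, and ρ_n ≥ 9L_n; the iterates are initialized with Φ_n^1 = Φ^1 and Λ_n^1 = −∇f_n(Φ^1) for all n ∈ T, and for every k ≥ 1 the point (α^{k+1}, Φ^{k+1}) lies in C, minimizes the surrogate U^k over C, and Φ_n^{k+1} = Φ^{k+1} − (∇f_n(Φ^{k+1}) + Λ_n^k)/(ρ_n + L_n), Λ_n^{k+1} = Λ_n^k + ρ_n(Φ_n^{k+1} − Φ^{k+1}). Then, as k → ∞, ‖Φ^{k+1} − Φ^k‖ → 0, |α^{k+1} − α^k| → 0, and for every n ∈ T: ‖Φ_n^{k+1} − Φ_n^k‖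 → 0, ‖Λ_n^{k+1} − Λ_n^k‖ → 0, and ‖Φ_n^k − Φ^k‖ → 0. -/
open RealInnerProductSpace

open Filter Topology

section Helpers

variable {E : Type*} [NormedAddCommGroup E] [InnerProductSpace ℝ E]

/-- First-order Taylor estimate for a function with Lipschitz gradient (non-sharp constant). -/
lemma abs_sub_sub_inner_le_of_lipschitz_gradient {f : E → ℝ} {f' : E → E} {L : ℝ} (hL : 0 ≤ L)
    (hf : ∀ x, HasFDerivAt f (InnerProductSpace.toDualMap ℝ E (f' x)) x)
    (hLip : ∀ x y, ‖f' x - f' y‖ ≤ L * ‖x - y‖) (x y : E) :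
    |f y - f x - ⟪f' x, y - x⟫| ≤ L * ‖y - x‖ ^ 2 := by
  have key := (convex_segment x y).norm_image_sub_le_of_norm_hasFDerivWithin_le'
    (f := f) (φ := InnerProductSpace.toDualMap ℝ E (f' x)) (C := L * ‖y - x‖)
    (fun z _ => (hf z).hasFDerivWithinAt) (fun z hz => ?_)
    (left_mem_segment ℝ x y) (right_mem_segment ℝ x y)
  · rw [InnerProductSpace.toDualMap_apply_apply, Real.norm_eq_abs] at key
    linarith
  · rw [← map_sub, LinearIsometry.norm_map]
    exact (hLip z x).trans (mul_le_mul_of_nonneg_left (norm_sub_le_of_mem_segment hz) hL)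

lemma dual_residual_of_update {g x y lam lam' : E} {L ρ : ℝ} (hne : ρ + L ≠ 0)
    (hy : y = x - (ρ + L)⁻¹ • (g + lam)) (hlam : lam' = lam + ρ • (y - x)) :
    g + lam = -((ρ + L) • (y - x)) ∧ lam' + g = -(L • (y - x)) := by
  have h1 : g + lam = -((ρ + L) • (y - x)) := by
    rw [hy, sub_sub_cancel_left, smul_neg, neg_neg, smul_inv_smul₀ hne]
  refine ⟨h1, ?_⟩
  rw [hlam, show lam + ρ • (y - x) + g = (g + lam) + ρ • (y - x) by abel, h1]
  module

lemma augmented_node_nonneg {f : E → ℝ} {f' : E → E} {L ρ : ℝ} (hL : 0 < L) (hρ : 9 * L ≤ ρ)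
    (hf : ∀ x, HasFDerivAt f (InnerProductSpace.toDualMap ℝ E (f' x)) x)
    (hLip : ∀ x y, ‖f' x - f' y‖ ≤ L * ‖x - y‖) (hpos : ∀ x, 0 ≤ f x)
    {x y lam : E} (hres : lam + f' x = -(L • (y - x))) :
    0 ≤ f y + ⟪lam, y - x⟫ + ρ / 2 * ‖y - x‖ ^ 2 := by
  have h1 := (abs_le.mp (abs_sub_sub_inner_le_of_lipschitz_gradient hL.le hf hLip x y)).1
  have h2 : ⟪lam, y - x⟫ = -(L * ‖y - x‖ ^ 2) - ⟪f' x, y - x⟫ := by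
    rw [eq_sub_of_add_eq hres, inner_sub_left, inner_neg_left, real_inner_smul_left,
      real_inner_self_eq_norm_sq]
  have h3 := hpos x
  have h4 := mul_nonneg (show 0 ≤ ρ / 2 - 2 * L by linarith) (sq_nonneg ‖y - x‖)
  linarith

lemma augmented_node_update_le {f : E → ℝ} {f' : E → E} {L ρ : ℝ} (hL : 0 < L) (hρ : 9 * L ≤ ρ)
    (hf : ∀ x, HasFDerivAt f (InnerProductSpace.toDualMap ℝ E (f' x)) x)
    (hLip : ∀ x y, ‖f' x - f' y‖ ≤ L * ‖x - y‖)
    {x x' y y' lam lam' : E} (hres : lam + f' x = -(L • (y - x)))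
    (hy : y' = x' - (ρ + L)⁻¹ • (f' x' + lam)) (hlam : lam' = lam + ρ • (y' - x')) :
    f y' + ⟪lam', y' - x'⟫ + ρ / 2 * ‖y' - x'‖ ^ 2 + ρ * ‖y' - x'‖ ^ 2 ≤
      f y + ⟪lam, y - x'⟫ + ρ / 2 * ‖y - x'‖ ^ 2 + ρ / 4 * ‖x' - x‖ ^ 2
        + ρ / 2 * ‖y - x‖ ^ 2 := by
  have hρ0 : 0 < ρ := by linarith
  obtain ⟨hg, -⟩ := dual_residual_of_update (by linarith) hy hlam
  have hup := (abs_le.mp (abs_sub_sub_inner_le_of_lipschitz_gradient hL.le hf hLip x' y')).2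
  have hlow := (abs_le.mp (abs_sub_sub_inner_le_of_lipschitz_gradient hL.le hf hLip x' y)).1
  have hbound : 10 * ‖y' - x'‖ ≤ ‖x' - x‖ + ‖y - x‖ := by
    have e : (ρ + L) • (y' - x') = L • (y - x) - (f' x' - f' x) := by
      rw [← neg_eq_iff_eq_neg.mpr hg, eq_sub_of_add_eq hres]
      abel
    have h1 : (ρ + L) * ‖y' - x'‖ ≤ L * ‖y - x‖ + L * ‖x' - x‖ := by
      calc (ρ + L) * ‖y' - x'‖ = ‖(ρ + L) • (y' - x')‖ := by
            rw [norm_smul, Real.norm_of_nonneg (by linarith)]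
        _ ≤ ‖L • (y - x)‖ + ‖f' x' - f' x‖ := e ▸ norm_sub_le _ _
        _ ≤ L * ‖y - x‖ + L * ‖x' - x‖ := by
            rw [norm_smul, Real.norm_of_nonneg hL.le]
            gcongr
            exact hLip _ _
    have h2 := mul_le_mul_of_nonneg_right hρ (norm_nonneg (y' - x'))
    refine le_of_mul_le_mul_left ?_ hL
    linarith
  have hlam_inner : ⟪lam', y' - x'⟫ = ⟪lam, y' - x'⟫ + ρ * ‖y' - x'‖ ^ 2 := by
    rw [hlam, inner_add_left, real_inner_smul_left, real_inner_self_eq_norm_sq]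
  have hr : ⟪f' x', y' - x'⟫ + ⟪lam, y' - x'⟫ = -((ρ + L) * ‖y' - x'‖ ^ 2) := by
    rw [← inner_add_left, hg, inner_neg_left, real_inner_smul_left, real_inner_self_eq_norm_sq]
  have hu : ⟪f' x', y - x'⟫ + ⟪lam, y - x'⟫ = -((ρ + L) * ⟪y' - x', y - x'⟫) := by
    rw [← inner_add_left, hg, inner_neg_left, real_inner_smul_left]
  have hcs := real_inner_le_norm (y' - x') (y - x')
  rw [hlam_inner]
  have hr0 := norm_nonneg (y' - x')
  have hu0 := norm_nonneg (y - x')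
  generalize ‖y' - x'‖ = r at *
  generalize ⟪y' - x', y - x'⟫ = w at *
  generalize ‖y - x'‖ = u at *
  generalize ‖x' - x‖ = d at *
  generalize ‖y - x‖ = q at *
  have hcross : (ρ + L) * w ≤ ρ * (7 / 18 * u ^ 2 + 4 / 5 * r ^ 2) := by
    calc (ρ + L) * w ≤ (10 / 9 * ρ) * (r * u) :=
          (mul_le_mul_of_nonneg_left hcs (by linarith)).trans
            (mul_le_mul_of_nonneg_right (by linarith) (mul_nonneg hr0 hu0))
      _ = ρ * (10 / 9 * (r * u)) := by ring
      _ ≤ ρ * (7 / 18 * u ^ 2 + 4 / 5 * r ^ 2) := by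
          refine mul_le_mul_of_nonneg_left ?_ hρ0.le
          nlinarith [sq_nonneg (u - 10 / 7 * r), sq_nonneg r]
  have hu2 : L * u ^ 2 ≤ ρ / 9 * u ^ 2 :=
    mul_le_mul_of_nonneg_right (by linarith) (sq_nonneg u)
  have hr2 : ρ * r ^ 2 ≤ ρ * ((d ^ 2 + q ^ 2) / 50) := by
    refine mul_le_mul_of_nonneg_left ?_ hρ0.le
    nlinarith [sq_nonneg (d - q), mul_le_mul hbound hbound (by positivity) (by linarith)]
  have hd2 := mul_nonneg hρ0.le (sq_nonneg d)
  have hq2 := mul_nonneg hρ0.le (sq_nonneg q)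
  linarith

/-- Minimality of the quadratic surrogate against the midpoint with the current iterate. -/
lemma surrogate_midpoint_decrease {ι : Type*} (T : Finset ι) {c a a' A Lα L : ℝ}
    {g x x' : E} {F ρ : ι → ℝ} {y lam : ι → E}
    (hmin : c + A * (a' - a) + ⟪g, x' - x⟫ + Lα / 2 * (a' - a) ^ 2 + L / 2 * ‖x' - x‖ ^ 2
        + ∑ n ∈ T, (F n + ⟪lam n, y n - x'⟫ + ρ n / 2 * ‖y n - x'‖ ^ 2)
      ≤ c + A * (midpoint ℝ a' a - a) + ⟪g, midpoint ℝ x' x - x⟫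
        + Lα / 2 * (midpoint ℝ a' a - a) ^ 2 + L / 2 * ‖midpoint ℝ x' x - x‖ ^ 2
        + ∑ n ∈ T, (F n + ⟪lam n, y n - midpoint ℝ x' x⟫
            + ρ n / 2 * ‖y n - midpoint ℝ x' x‖ ^ 2)) :
    c + A * (a' - a) + ⟪g, x' - x⟫ + Lα / 2 * (a' - a) ^ 2 + L / 2 * ‖x' - x‖ ^ 2
        + ∑ n ∈ T, (F n + ⟪lam n, y n - x'⟫ + ρ n / 2 * ‖y n - x'‖ ^ 2
            + ρ n / 4 * ‖x' - x‖ ^ 2)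
        + Lα / 4 * (a' - a) ^ 2 + L / 4 * ‖x' - x‖ ^ 2
      ≤ c + ∑ n ∈ T, (F n + ⟪lam n, y n - x⟫ + ρ n / 2 * ‖y n - x‖ ^ 2) := by
  have hm : midpoint ℝ x' x - x = (1 / 2 : ℝ) • (x' - x) := by
    rw [midpoint_eq_smul_add, invOf_eq_inv]; module
  have ha : midpoint ℝ a' a - a = (a' - a) / 2 := by
    rw [midpoint_eq_smul_add, invOf_eq_inv, smul_eq_mul]; ring
  have hnode : ∀ n, F n + ⟪lam n, y n - midpoint ℝ x' x⟫
      + ρ n / 2 * ‖y n - midpoint ℝ x' x‖ ^ 2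
      = (1 / 2) * (F n + ⟪lam n, y n - x⟫ + ρ n / 2 * ‖y n - x‖ ^ 2)
        + (1 / 2) * (F n + ⟪lam n, y n - x'⟫ + ρ n / 2 * ‖y n - x'‖ ^ 2)
        - (1 / 2) * (ρ n / 4 * ‖x' - x‖ ^ 2) := by
    intro n
    have e1 : y n - midpoint ℝ x' x = (1 / 2 : ℝ) • ((y n - x) + (y n - x')) := by
      rw [midpoint_eq_smul_add, invOf_eq_inv]; module
    have e2 : (y n - x) - (y n - x') = x' - x := by abel
    have hp := parallelogram_law_with_norm ℝ (y n - x) (y n - x')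
    rw [e2] at hp
    rw [e1, real_inner_smul_right, inner_add_right, norm_smul, mul_pow,
      Real.norm_of_nonneg (by norm_num)]
    linear_combination (ρ n / 8) * hp
  rw [hm, ha, real_inner_smul_right, norm_smul, mul_pow, Real.norm_of_nonneg (by norm_num),
    Finset.sum_congr rfl fun n _ => hnode n, Finset.sum_sub_distrib,
    Finset.sum_add_distrib
      (f := fun n => (1 / 2) * (F n + ⟪lam n, y n - x⟫ + ρ n / 2 * ‖y n - x‖ ^ 2)),
    ← Finset.mul_sum, ← Finset.mul_sum, ← Finset.mul_sum] at hmin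
  rw [Finset.sum_add_distrib (f := fun n => F n + ⟪lam n, y n - x'⟫ + ρ n / 2 * ‖y n - x'‖ ^ 2)]
  linarith

/-- If a nonnegative sequence decreases by at least `g k`, then `g` tends to zero. -/
lemma tendsto_zero_of_add_le {V g : ℕ → ℝ} (hV : ∀ k ≥ 2, 0 ≤ V k) (hg : ∀ k, 0 ≤ g k)
    (hdec : ∀ k ≥ 2, V (k + 1) + g k ≤ V k) : Tendsto g atTop (𝓝 0) := by
  have hanti : Antitone fun k => V (k + 2) := antitone_nat_of_succ_le fun k => by
    have := hdec (k + 2) (by omega)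
    have := hg (k + 2)
    rw [show k + 1 + 2 = k + 2 + 1 by ring]
    linarith
  have hlim := tendsto_atTop_ciInf hanti ⟨0, by rintro _ ⟨k, rfl⟩; exact hV _ (by omega)⟩
  have hdiff := hlim.sub (hlim.comp (tendsto_add_atTop_nat 1))
  rw [sub_self] at hdiff
  rw [← tendsto_add_atTop_iff_nat 2]
  refine squeeze_zero (fun k => hg _) (fun k => ?_) hdiff
  have := hdec (k + 2) (by omega)
  simp only [Function.comp_apply]
  rw [show k + 1 + 2 = k + 2 + 1 by ring]
  linarith

lemma tendsto_zero_of_mul_sq_le {g u : ℕ → ℝ} {c : ℝ} (hc : 0 < c) (hu : ∀ k, 0 ≤ u k)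
    (hle : ∀ k, c * u k ^ 2 ≤ g k) (hg : Tendsto g atTop (𝓝 0)) : Tendsto u atTop (𝓝 0) := by
  have h1 : Tendsto (fun k => u k ^ 2) atTop (𝓝 0) := by
    refine squeeze_zero (fun k => sq_nonneg _) (fun k => ?_) (by simpa using hg.div_const c)
    rw [le_div_iff₀ hc]
    linarith [hle k]
  simpa [Real.sqrt_sq (hu _)] using h1.sqrt

end Helpers

/-- Under the stated assumptions on the consensus-ADMM iteration
(with `ρ_n ≥ 9L_n`), the successive differences of all iterates tend to zero,
and `‖Φ_n^k − Φ^k‖ → 0` for every `n ∈ T`. -/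
theorem stmt_0 {E : Type*} [NormedAddCommGroup E] [InnerProductSpace ℝ E]
    {ι : Type*} (T : Finset ι)
    (h : ℝ × E → ℝ) (dah : ℝ × E → ℝ) (dΦh : ℝ × E → E)
    (hda : ∀ α (Φ : E), HasDerivAt (fun t => h (t, Φ)) (dah (α, Φ)) α)
    (hdΦ : ∀ α (Φ : E),
      HasFDerivAt (fun x => h (α, x)) (InnerProductSpace.toDualMap ℝ E (dΦh (α, Φ))) Φ)
    (Lα L : ℝ) (hLα : 0 < Lα) (hL : 0 < L)
    (hhpos : ∀ p, 0 ≤ h p)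
    (hdesc : ∀ (α : ℝ) (Φ : E) (α' : ℝ) (Φ' : E),
      h (α', Φ') ≤ h (α, Φ) + dah (α, Φ) * (α' - α) + ⟪dΦh (α, Φ), Φ' - Φ⟫
        + Lα / 2 * (α' - α) ^ 2 + L / 2 * ‖Φ' - Φ‖ ^ 2)
    (f : ι → E → ℝ) (f' : ι → E → E)
    (hgrad : ∀ n ∈ T, ∀ x, HasFDerivAt (f n) (InnerProductSpace.toDualMap ℝ E (f' n x)) x)
    (Ln : ι → ℝ) (hLn : ∀ n ∈ T, 0 < Ln n)
    (hLip : ∀ n ∈ T, ∀ x y, ‖f' n x - f' n y‖ ≤ Ln n * ‖x - y‖)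
    (hfpos : ∀ n ∈ T, ∀ x, 0 ≤ f n x)
    (ρ : ι → ℝ) (hρ : ∀ n ∈ T, 9 * Ln n ≤ ρ n)
    (C : Set (ℝ × E)) (hC : Convex ℝ C)
    (α : ℕ → ℝ) (Φ : ℕ → E) (Φv Λv : ℕ → ι → E)
    (hinitΦ : ∀ n ∈ T, Φv 1 n = Φ 1)
    (hinitΛ : ∀ n ∈ T, Λv 1 n = -f' n (Φ 1))
    (hmem : ∀ k ≥ 1, (α (k + 1), Φ (k + 1)) ∈ C)
    (hmin : ∀ k ≥ 1, ∀ p ∈ C,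
      h (α k, Φ k) + dah (α k, Φ k) * (α (k + 1) - α k)
          + ⟪dΦh (α k, Φ k), Φ (k + 1) - Φ k⟫
          + Lα / 2 * (α (k + 1) - α k) ^ 2 + L / 2 * ‖Φ (k + 1) - Φ k‖ ^ 2
          + ∑ n ∈ T, (f n (Φv k n) + ⟪Λv k n, Φv k n - Φ (k + 1)⟫
              + ρ n / 2 * ‖Φv k n - Φ (k + 1)‖ ^ 2)
        ≤ h (α k, Φ k) + dah (α k, Φ k) * (p.1 - α k) + ⟪dΦh (α k, Φ k), p.2 - Φ k⟫
          + Lα / 2 * (p.1 - α k) ^ 2 + L / 2 * ‖p.2 - Φ k‖ ^ 2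
          + ∑ n ∈ T, (f n (Φv k n) + ⟪Λv k n, Φv k n - p.2⟫
              + ρ n / 2 * ‖Φv k n - p.2‖ ^ 2))
    (hupΦ : ∀ k ≥ 1, ∀ n ∈ T,
      Φv (k + 1) n = Φ (k + 1) - (ρ n + Ln n)⁻¹ • (f' n (Φ (k + 1)) + Λv k n))
    (hupΛ : ∀ k ≥ 1, ∀ n ∈ T,
      Λv (k + 1) n = Λv k n + ρ n • (Φv (k + 1) n - Φ (k + 1))) :
    Filter.Tendsto (fun k => ‖Φ (k + 1) - Φ k‖) Filter.atTop (nhds 0) ∧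
    Filter.Tendsto (fun k => |α (k + 1) - α k|) Filter.atTop (nhds 0) ∧
    ∀ n ∈ T,
      Filter.Tendsto (fun k => ‖Φv (k + 1) n - Φv k n‖) Filter.atTop (nhds 0) ∧
      Filter.Tendsto (fun k => ‖Λv (k + 1) n - Λv k n‖) Filter.atTop (nhds 0) ∧
      Filter.Tendsto (fun k => ‖Φv k n - Φ k‖) Filter.atTop (nhds 0) := by
  set P : ℕ → ι → ℝ := fun k n =>
    f n (Φv k n) + ⟪Λv k n, Φv k n - Φ k⟫ + ρ n / 2 * ‖Φv k n - Φ k‖ ^ 2 with hP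
  set V : ℕ → ℝ := fun k =>
    h (α k, Φ k) + ∑ n ∈ T, (P k n + ρ n * ‖Φv k n - Φ k‖ ^ 2) with hVdef
  set g : ℕ → ℝ := fun k => Lα / 4 * (α (k + 1) - α k) ^ 2 + L / 4 * ‖Φ (k + 1) - Φ k‖ ^ 2
    + ∑ n ∈ T, ρ n / 2 * ‖Φv k n - Φ k‖ ^ 2 with hgdef
  have hρpos : ∀ n ∈ T, 0 < ρ n := fun n hn => by linarith [hρ n hn, hLn n hn]
  have hres : ∀ k ≥ 1, ∀ n ∈ T, Λv k n + f' n (Φ k) = -(Ln n • (Φv k n - Φ k)) := by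
    intro k hk n hn
    obtain rfl | ⟨j, hj, rfl⟩ : k = 1 ∨ ∃ j ≥ 1, k = j + 1 := by
      rcases hk.eq_or_lt with h1 | h1
      · exact .inl h1.symm
      · exact .inr ⟨k - 1, by omega, by omega⟩
    · simp [hinitΦ n hn, hinitΛ n hn]
    · exact (dual_residual_of_update (by linarith [hρpos n hn, hLn n hn])
        (hupΦ j hj n hn) (hupΛ j hj n hn)).2
  have hsum0 : ∀ k, ∀ n ∈ T, 0 ≤ ρ n / 2 * ‖Φv k n - Φ k‖ ^ 2 := fun k n hn => by
    have := hρpos n hn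
    positivity
  have hg0 : ∀ k, 0 ≤ g k := fun k => by
    have := Finset.sum_nonneg (hsum0 k)
    positivity
  have hV0 : ∀ k ≥ 2, 0 ≤ V k := fun k hk => by
    refine add_nonneg (hhpos _) (Finset.sum_nonneg fun n hn => add_nonneg ?_ ?_)
    · exact augmented_node_nonneg (hLn n hn) (hρ n hn) (hgrad n hn) (hLip n hn) (hfpos n hn)
        (hres k (by omega) n hn)
    · linarith [hsum0 k n hn]
  have hdec : ∀ k ≥ 2, V (k + 1) + g k ≤ V k := by
    intro k hk
    have hk1 : k ≥ 1 := by omega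
    have hkC : (α k, Φ k) ∈ C := by
      have := hmem (k - 1) (by omega)
      rwa [Nat.sub_add_cancel hk1] at this
    have hsur := surrogate_midpoint_decrease T (hmin k hk1
      (midpoint ℝ (α (k + 1)) (α k), midpoint ℝ (Φ (k + 1)) (Φ k))
      (hC.midpoint_mem (hmem k hk1) hkC))
    have hd := hdesc (α k) (Φ k) (α (k + 1)) (Φ (k + 1))
    have hnodes := Finset.sum_le_sum fun n hn => augmented_node_update_le (hLn n hn) (hρ n hn)
      (hgrad n hn) (hLip n hn) (hres k hk1 n hn) (hupΦ k hk1 n hn) (hupΛ k hk1 n hn)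
    have hsplit : ∑ n ∈ T, (P k n + ρ n * ‖Φv k n - Φ k‖ ^ 2) = ∑ n ∈ T, P k n
        + ∑ n ∈ T, ρ n / 2 * ‖Φv k n - Φ k‖ ^ 2 + ∑ n ∈ T, ρ n / 2 * ‖Φv k n - Φ k‖ ^ 2 := by
      rw [← Finset.sum_add_distrib, ← Finset.sum_add_distrib]
      exact Finset.sum_congr rfl fun n _ => by ring
    rw [Finset.sum_add_distrib (g := fun n => ρ n / 2 * ‖Φv k n - Φ k‖ ^ 2)] at hnodes
    simp only [hVdef, hgdef]
    rw [hsplit]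
    simp only [hP]
    linarith
  have hg := tendsto_zero_of_add_le hV0 hg0 hdec
  have hΦ : Tendsto (fun k => ‖Φ (k + 1) - Φ k‖) atTop (𝓝 0) := by
    refine tendsto_zero_of_mul_sq_le (c := L / 4) (by linarith) (fun k => norm_nonneg _)
      (fun k => ?_) hg
    have := Finset.sum_nonneg (hsum0 k)
    have := mul_nonneg hLα.le (sq_nonneg (α (k + 1) - α k))
    simp only [hgdef]
    linarith
  have hα : Tendsto (fun k => |α (k + 1) - α k|) atTop (𝓝 0) := by
    refine tendsto_zero_of_mul_sq_le (c := Lα / 4) (by linarith) (fun k => abs_nonneg _)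
      (fun k => ?_) hg
    have := Finset.sum_nonneg (hsum0 k)
    have := mul_nonneg hL.le (sq_nonneg ‖Φ (k + 1) - Φ k‖)
    simp only [hgdef, sq_abs]
    linarith
  refine ⟨hΦ, hα, fun n hn => ?_⟩
  have hr : Tendsto (fun k => ‖Φv k n - Φ k‖) atTop (𝓝 0) := by
    refine tendsto_zero_of_mul_sq_le (c := ρ n / 2) (half_pos (hρpos n hn))
      (fun k => norm_nonneg _) (fun k => ?_) hg
    have := Finset.single_le_sum (hsum0 k) hn
    have := mul_nonneg hL.le (sq_nonneg ‖Φ (k + 1) - Φ k‖)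
    have := mul_nonneg hLα.le (sq_nonneg (α (k + 1) - α k))
    simp only [hgdef]
    linarith
  have hr' : Tendsto (fun k => ‖Φv (k + 1) n - Φ (k + 1)‖) atTop (𝓝 0) :=
    hr.comp (tendsto_add_atTop_nat 1)
  refine ⟨?_, ?_, hr⟩
  · refine squeeze_zero (fun k => norm_nonneg _) (fun k => ?_)
      (by simpa using (hr'.add hΦ).add hr)
    calc ‖Φv (k + 1) n - Φv k n‖
        = ‖(Φv (k + 1) n - Φ (k + 1)) + (Φ (k + 1) - Φ k) - (Φv k n - Φ k)‖ := by
          congr 1; abel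
      _ ≤ _ := (norm_sub_le _ _).trans (add_le_add_left (norm_add_le _ _) _)
  · refine (by simpa using hr'.const_mul (ρ n) :
      Tendsto (fun k => ρ n * ‖Φv (k + 1) n - Φ (k + 1)‖) atTop (𝓝 0)).congr' ?_
    filter_upwards [eventually_ge_atTop 1] with k hk
    rw [hupΛ k hk n hn, add_sub_cancel_left, norm_smul, Real.norm_of_nonneg (hρpos n hn).le]
end

section
/- Consider the consensus-ADMM iteration and assume: h is differentiable with ∂_αh and ∇_Φh continuous on ℝ × E; for every n ∈ T, f_n has L_n-Lipschitz gradient and ρ_n > 0; L_α > 0 and L > 0; C = A × D where A ⊆ ℝ and D ⊆ E are convex; for every k ≥ 1, (α^{k+1}, Φ^{k+1}) lies in C, minimizes the surrogate U^k over C, and Φ_n^{k+1} = Φ^{k+1} − (∇f_n(Φ^{k+1}) + Λ_n^k)/(ρ_n + L_n), Λ_n^{k+1} = Λ_n^k + ρ_n(Φ_n^{k+1} − Φ^{k+1}). Suppose the iterates converge: α^k → α*, Φ^k → Φ*, Φ_n^k → Φ_n*, and Λ_n^k → Λ_n* for every n ∈ T. Then Φ_n* = Φ* and Λ_n* = −∇f_n(Φ*)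 for every n ∈ T, and (α*, Φ*) is a stationary point: ∂_αh(α*,Φ*)·(α − α*) ≥ 0 for all α ∈ A, and ⟨∇_Φh(α*,Φ*) + Σ_{n∈T} ∇f_n(Φ*), Φ − Φ*⟩ ≥ 0 for all Φ ∈ D. -/
open RealInnerProductSpace

/-- A quadratic polynomial without constant term that is nonnegative on `(0, 1]` has a nonnegative
linear coefficient. -/
lemma nonneg_of_forall_linear_add_quadratic_nonneg {b c : ℝ}
    (H : ∀ t : ℝ, 0 < t → t ≤ 1 → 0 ≤ t * b + t ^ 2 * c) : 0 ≤ b := by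
  by_contra! hb
  have hden : 0 < |c| - b := by linarith [abs_nonneg c]
  set t := -b / (2 * (|c| - b)) with ht
  have ht0 : 0 < t := by apply div_pos <;> linarith
  have ht1 : t ≤ 1 := by rw [ht, div_le_one (by linarith)]; linarith [abs_nonneg c]
  have hmul : t * (2 * (|c| - b)) = -b := by rw [ht]; field_simp
  have hq : 0 ≤ b + t * c := by
    have := H t ht0 ht1
    have h2 : 0 ≤ t * (b + t * c) := by linarith [show t * (b + t * c) = t * b + t ^ 2 * c by ring]
    exact nonneg_of_mul_nonneg_right h2 ht0
  have hc : t * c ≤ t * |c| := by gcongr; exact le_abs_self c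
  nlinarith [mul_pos ht0 (neg_pos.mpr hb)]

/-- Expansion of a squared norm after a step `t • d`. -/
lemma norm_add_smul_sq {E : Type*} [NormedAddCommGroup E] [InnerProductSpace ℝ E]
    (u d : E) (t : ℝ) :
    ‖u + t • d‖ ^ 2 = ‖u‖ ^ 2 + 2 * (t * ⟪u, d⟫) + t ^ 2 * ‖d‖ ^ 2 := by
  rw [norm_add_sq_real, inner_smul_right, norm_smul, mul_pow, Real.norm_eq_abs, sq_abs]

/-- Expansion of an augmented Lagrangian sum after moving the consensus variable by `t • d`. -/
lemma sum_augmented_lagrangian_add_smul {E ι : Type*} [NormedAddCommGroup E]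
    [InnerProductSpace ℝ E] (T : Finset ι) (c : ι → ℝ) (lam v : ι → E) (ρ : ι → ℝ)
    (u d : E) (t : ℝ) :
    ∑ n ∈ T, (c n + ⟪lam n, v n - (u + t • d)⟫ + ρ n / 2 * ‖v n - (u + t • d)‖ ^ 2) =
      ∑ n ∈ T, (c n + ⟪lam n, v n - u⟫ + ρ n / 2 * ‖v n - u‖ ^ 2)
        - t * ∑ n ∈ T, ⟪lam n + ρ n • (v n - u), d⟫
        + t ^ 2 * ∑ n ∈ T, ρ n / 2 * ‖d‖ ^ 2 := by
  rw [Finset.mul_sum, Finset.mul_sum, ← Finset.sum_sub_distrib, ← Finset.sum_add_distrib]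
  refine Finset.sum_congr rfl fun n _ => ?_
  have e : v n - (u + t • d) = (v n - u) + (-t) • d := by rw [neg_smul]; abel
  rw [e, norm_add_smul_sq, inner_add_right, inner_smul_right, inner_add_left,
    real_inner_smul_left]
  ring

/-- If the consensus-ADMM iterates converge, then the limit satisfies
`Φ_n* = Φ*`, `Λ_n* = −∇f_n(Φ*)`, and `(α*, Φ*)` is a stationary point:
`∂_αh(α*,Φ*)(α − α*) ≥ 0` on `A` and
`⟨∇_Φh(α*,Φ*) + Σ_n ∇f_n(Φ*), Φ − Φ*⟩ ≥ 0` on `D`. -/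
theorem stmt_1 {E : Type*} [NormedAddCommGroup E] [InnerProductSpace ℝ E]
    {ι : Type*} (T : Finset ι)
    (h : ℝ × E → ℝ) (dah : ℝ × E → ℝ) (dΦh : ℝ × E → E)
    (hda : ∀ α (Φ : E), HasDerivAt (fun t => h (t, Φ)) (dah (α, Φ)) α)
    (hdΦ : ∀ α (Φ : E),
      HasFDerivAt (fun x => h (α, x)) (InnerProductSpace.toDualMap ℝ E (dΦh (α, Φ))) Φ)
    (hcont_a : Continuous dah) (hcont_Φ : Continuous dΦh)
    (f : ι → E → ℝ) (f' : ι → E → E)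
    (hgrad : ∀ n ∈ T, ∀ x, HasFDerivAt (f n) (InnerProductSpace.toDualMap ℝ E (f' n x)) x)
    (Ln : ι → ℝ)
    (hLip : ∀ n ∈ T, ∀ x y, ‖f' n x - f' n y‖ ≤ Ln n * ‖x - y‖)
    (ρ : ι → ℝ) (hρ : ∀ n ∈ T, 0 < ρ n)
    (Lα L : ℝ) (hLα : 0 < Lα) (hL : 0 < L)
    (A : Set ℝ) (D : Set E) (hA : Convex ℝ A) (hD : Convex ℝ D)
    (α : ℕ → ℝ) (Φ : ℕ → E) (Φv Λv : ℕ → ι → E)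
    (hmem : ∀ k ≥ 1, (α (k + 1), Φ (k + 1)) ∈ A ×ˢ D)
    (hmin : ∀ k ≥ 1, ∀ p ∈ A ×ˢ D,
      h (α k, Φ k) + dah (α k, Φ k) * (α (k + 1) - α k)
          + ⟪dΦh (α k, Φ k), Φ (k + 1) - Φ k⟫
          + Lα / 2 * (α (k + 1) - α k) ^ 2 + L / 2 * ‖Φ (k + 1) - Φ k‖ ^ 2
          + ∑ n ∈ T, (f n (Φv k n) + ⟪Λv k n, Φv k n - Φ (k + 1)⟫
              + ρ n / 2 * ‖Φv k n - Φ (k + 1)‖ ^ 2)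
        ≤ h (α k, Φ k) + dah (α k, Φ k) * (p.1 - α k) + ⟪dΦh (α k, Φ k), p.2 - Φ k⟫
          + Lα / 2 * (p.1 - α k) ^ 2 + L / 2 * ‖p.2 - Φ k‖ ^ 2
          + ∑ n ∈ T, (f n (Φv k n) + ⟪Λv k n, Φv k n - p.2⟫
              + ρ n / 2 * ‖Φv k n - p.2‖ ^ 2))
    (hupΦ : ∀ k ≥ 1, ∀ n ∈ T,
      Φv (k + 1) n = Φ (k + 1) - (ρ n + Ln n)⁻¹ • (f' n (Φ (k + 1)) + Λv k n))
    (hupΛ : ∀ k ≥ 1, ∀ n ∈ T,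
      Λv (k + 1) n = Λv k n + ρ n • (Φv (k + 1) n - Φ (k + 1)))
    (αs : ℝ) (Φs : E) (Φns Λns : ι → E)
    (hcα : Filter.Tendsto α Filter.atTop (nhds αs))
    (hcΦ : Filter.Tendsto Φ Filter.atTop (nhds Φs))
    (hcΦn : ∀ n ∈ T, Filter.Tendsto (fun k => Φv k n) Filter.atTop (nhds (Φns n)))
    (hcΛn : ∀ n ∈ T, Filter.Tendsto (fun k => Λv k n) Filter.atTop (nhds (Λns n))) :
    (∀ n ∈ T, Φns n = Φs ∧ Λns n = -f' n Φs) ∧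
    (∀ a ∈ A, 0 ≤ dah (αs, Φs) * (a - αs)) ∧
    (∀ x ∈ D, 0 ≤ ⟪dΦh (αs, Φs) + ∑ n ∈ T, f' n Φs, x - Φs⟫) := by
  have hlim : ∀ n ∈ T, Φns n = Φs ∧ Λns n = -f' n Φs := by
    intro n hn
    rcases subsingleton_or_nontrivial E with hE | hE
    · exact ⟨Subsingleton.elim _ _, Subsingleton.elim _ _⟩
    obtain ⟨x, y, hxy⟩ := exists_pair_ne E
    have hLn : 0 ≤ Ln n :=
      nonneg_of_mul_nonneg_left ((norm_nonneg _).trans (hLip n hn x y))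
        (norm_pos_iff.mpr (sub_ne_zero.mpr hxy))
    have hΦ1 := hcΦ.comp (Filter.tendsto_add_atTop_nat 1)
    have hv1 := (hcΦn n hn).comp (Filter.tendsto_add_atTop_nat 1)
    have hΛ1 := (hcΛn n hn).comp (Filter.tendsto_add_atTop_nat 1)
    have hf'c : Continuous (f' n) :=
      (LipschitzWith.of_dist_le_mul (K := ⟨Ln n, hLn⟩) fun a b => by
        rw [dist_eq_norm, dist_eq_norm]; exact hLip n hn a b).continuous
    have e1 : Λns n = Λns n + ρ n • (Φns n - Φs) := by
      refine tendsto_nhds_unique_of_eventuallyEq hΛ1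
        ((hcΛn n hn).add ((hv1.sub hΦ1).const_smul (ρ n))) ?_
      filter_upwards [Filter.eventually_ge_atTop 1] with k hk
      exact hupΛ k hk n hn
    have hΦeq : Φns n = Φs := by
      have := left_eq_add.mp e1
      exact sub_eq_zero.mp ((smul_eq_zero.mp this).resolve_left (hρ n hn).ne')
    have e2 : Φns n = Φs - (ρ n + Ln n)⁻¹ • (f' n Φs + Λns n) := by
      refine tendsto_nhds_unique_of_eventuallyEq hv1
        (hΦ1.sub ((((hf'c.tendsto Φs).comp hΦ1).add (hcΛn n hn)).const_smul _)) ?_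
      filter_upwards [Filter.eventually_ge_atTop 1] with k hk
      exact hupΦ k hk n hn
    refine ⟨hΦeq, ?_⟩
    rw [hΦeq] at e2
    have h0 := (smul_eq_zero.mp (sub_eq_self.mp e2.symm)).resolve_left
      (inv_ne_zero (by linarith [hρ n hn]))
    exact eq_neg_of_add_eq_zero_right h0
  have hα1 : Filter.Tendsto (fun k => α (k + 1)) Filter.atTop (nhds αs) :=
    hcα.comp (Filter.tendsto_add_atTop_nat 1)
  have hΦ1 : Filter.Tendsto (fun k => Φ (k + 1)) Filter.atTop (nhds Φs) :=
    hcΦ.comp (Filter.tendsto_add_atTop_nat 1)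
  have hpair : Filter.Tendsto (fun k => (α k, Φ k)) Filter.atTop (nhds (αs, Φs)) :=
    hcα.prodMk_nhds hcΦ
  refine ⟨hlim, fun a ha => ?_, fun x hx => ?_⟩
  · have hvar : ∀ k ≥ 1,
        0 ≤ (dah (α k, Φ k) + Lα * (α (k + 1) - α k)) * (a - α (k + 1)) := by
      intro k hk
      refine nonneg_of_forall_linear_add_quadratic_nonneg
        (c := Lα / 2 * (a - α (k + 1)) ^ 2) fun t ht0 ht1 => ?_
      have hk1 := hmem k hk
      have hp := hA.add_smul_sub_mem hk1.1 ha ⟨ht0.le, ht1⟩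
      have hm := hmin k hk (_, Φ (k + 1)) ⟨hp, hk1.2⟩
      simp only [smul_eq_mul] at hm
      linarith
    have hT := (((hcont_a.tendsto _).comp hpair).add ((hα1.sub hcα).const_mul Lα)).mul
      (hα1.const_sub a)
    rw [sub_self, mul_zero, add_zero] at hT
    refine ge_of_tendsto hT ?_
    filter_upwards [Filter.eventually_ge_atTop 1] with k hk
    exact hvar k hk
  · have hvar : ∀ k ≥ 1, 0 ≤ ⟪dΦh (α k, Φ k) + L • (Φ (k + 1) - Φ k), x - Φ (k + 1)⟫
        - ∑ n ∈ T, ⟪Λv k n + ρ n • (Φv k n - Φ (k + 1)), x - Φ (k + 1)⟫ := by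
      intro k hk
      refine nonneg_of_forall_linear_add_quadratic_nonneg
        (c := L / 2 * ‖x - Φ (k + 1)‖ ^ 2 + ∑ n ∈ T, ρ n / 2 * ‖x - Φ (k + 1)‖ ^ 2)
        fun t ht0 ht1 => ?_
      have hk1 := hmem k hk
      have hp := hD.add_smul_sub_mem hk1.2 hx ⟨ht0.le, ht1⟩
      have hm := hmin k hk (α (k + 1), Φ (k + 1) + t • (x - Φ (k + 1))) ⟨hk1.1, hp⟩
      dsimp only at hm
      rw [sum_augmented_lagrangian_add_smul T (fun n => f n (Φv k n)),
        add_sub_right_comm (Φ (k + 1)), norm_add_smul_sq, inner_add_right, inner_smul_right] at hm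
      rw [inner_add_left, real_inner_smul_left]
      linarith
    have hT := ((((hcont_Φ.tendsto _).comp hpair).add ((hΦ1.sub hcΦ).const_smul L)).inner
      (𝕜 := ℝ) (hΦ1.const_sub x)).sub (tendsto_finsetSum T fun n hn =>
        ((hcΛn n hn).add (((hcΦn n hn).sub hΦ1).const_smul (ρ n))).inner (𝕜 := ℝ)
          (hΦ1.const_sub x))
    have e : ∑ n ∈ T, ⟪Λns n + ρ n • (Φns n - Φs), x - Φs⟫ =
        -∑ n ∈ T, ⟪f' n Φs, x - Φs⟫ := by
      rw [← Finset.sum_neg_distrib]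
      refine Finset.sum_congr rfl fun n hn => ?_
      rw [(hlim n hn).1, (hlim n hn).2, sub_self, smul_zero, add_zero, inner_neg_left]
    rw [e, sub_self, smul_zero, add_zero, sub_neg_eq_add, ← sum_inner, ← inner_add_left] at hT
    refine ge_of_tendsto hT ?_
    filter_upwards [Filter.eventually_ge_atTop 1] with k hk
    exact hvar k hk
end

section
/- Define h : ℝ × ℝ^{N×M} → ℝ by h(α, Φ) = Σ_{θ∈Θ} (α P̄_θ − ‖X(Φ) a_θ‖²)². Then for each α ∈ ℝ the map Φ ↦ h(α, Φ) is differentiable on ℝ^{N×M}, and for every α_max > 0 there exists a constant L ≥ 0 such that for all α ∈ [0, α_max] and all Φ, Φ̂ ∈ ℝ^{N×M}: ‖∇_Φ h(α, Φ) − ∇_Φ h(α, Φ̂)‖_F ≤ L ‖Φ − Φ̂‖_F, where ‖·‖_F denotes the Frobenius norm. -/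
/-- A map between normed spaces that is bounded and Lipschitz, with a common constant. -/
def BoundedLipschitz {E F : Type*} [NormedAddCommGroup E] [NormedAddCommGroup F]
    (f : E → F) : Prop :=
  ∃ C : ℝ, 0 ≤ C ∧ (∀ x, ‖f x‖ ≤ C) ∧ ∀ x y, ‖f x - f y‖ ≤ C * ‖x - y‖

namespace BoundedLipschitz

variable {E F : Type*} [NormedAddCommGroup E] [NormedAddCommGroup F]

theorem const (c : F) : BoundedLipschitz fun _ : E => c :=
  ⟨‖c‖, norm_nonneg c, fun _ => le_rfl, fun x y => by
    simpa using mul_nonneg (norm_nonneg c) (norm_nonneg (x - y))⟩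

theorem add {f g : E → F} (hf : BoundedLipschitz f) (hg : BoundedLipschitz g) :
    BoundedLipschitz fun x => f x + g x := by
  obtain ⟨C, hC, hfb, hfl⟩ := hf
  obtain ⟨D, hD, hgb, hgl⟩ := hg
  refine ⟨C + D, add_nonneg hC hD, fun x => norm_add_le_of_le (hfb x) (hgb x), fun x y => ?_⟩
  rw [add_sub_add_comm, add_mul]
  exact norm_add_le_of_le (hfl x y) (hgl x y)

theorem smul [NormedSpace ℝ F] {f : E → ℝ} {g : E → F}
    (hf : BoundedLipschitz f) (hg : BoundedLipschitz g) :
    BoundedLipschitz fun x => f x • g x := by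
  obtain ⟨C, hC, hfb, hfl⟩ := hf
  obtain ⟨D, hD, hgb, hgl⟩ := hg
  have hCD : 0 ≤ C * D := mul_nonneg hC hD
  refine ⟨C * D + C * D, add_nonneg hCD hCD, fun x => ?_, fun x y => ?_⟩
  · rw [norm_smul]
    have := mul_le_mul (hfb x) (hgb x) (norm_nonneg _) hC
    linarith
  · have hsplit : f x • g x - f y • g y = f x • (g x - g y) + (f x - f y) • g y := by
      rw [smul_sub, sub_smul]; abel
    rw [hsplit, add_mul]
    refine norm_add_le_of_le ?_ ?_
    · rw [norm_smul, mul_assoc]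
      exact mul_le_mul (hfb x) (hgl x y) (norm_nonneg _) hC
    · rw [norm_smul]
      calc ‖f x - f y‖ * ‖g y‖ ≤ (C * ‖x - y‖) * D :=
            mul_le_mul (hfl x y) (hgb y) (norm_nonneg _) (mul_nonneg hC (norm_nonneg _))
        _ = C * D * ‖x - y‖ := by ring

variable [NormedSpace ℝ E]

theorem of_comp_clm {f : ℝ → ℝ} (hb : ∀ t, |f t| ≤ 1) (hl : ∀ s t, |f s - f t| ≤ |s - t|)
    (l : E →L[ℝ] ℝ) : BoundedLipschitz fun x => f (l x) := by
  refine ⟨1 + ‖l‖, by positivity, fun x => (hb _).trans (by simp), fun x y => ?_⟩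
  refine (hl _ _).trans ?_
  rw [← map_sub, ← Real.norm_eq_abs]
  refine (l.le_opNorm _).trans ?_
  gcongr
  simp

theorem sin (l : E →L[ℝ] ℝ) : BoundedLipschitz fun x => Real.sin (l x) :=
  of_comp_clm Real.abs_sin_le_one (fun s t => by
    simpa [Real.dist_eq] using Real.lipschitzWith_sin.dist_le_mul s t) l

theorem cos (l : E →L[ℝ] ℝ) : BoundedLipschitz fun x => Real.cos (l x) :=
  of_comp_clm Real.abs_cos_le_one (fun s t => by
    simpa [Real.dist_eq] using Real.lipschitzWith_cos.dist_le_mul s t) l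

end BoundedLipschitz

/-- A differentiable function that is bounded and Lipschitz together with its derivative. -/
structure BoundedSmooth {E : Type*} [NormedAddCommGroup E] [NormedSpace ℝ E]
    (f : E → ℝ) : Prop where
  differentiable : Differentiable ℝ f
  boundedLipschitz : BoundedLipschitz f
  fderiv : BoundedLipschitz (fderiv ℝ f)

namespace BoundedSmooth

variable {E : Type*} [NormedAddCommGroup E] [NormedSpace ℝ E]

theorem const (c : ℝ) : BoundedSmooth fun _ : E => c :=
  ⟨differentiable_const c, .const c, by
    rw [fderiv_fun_const]; exact .const 0⟩

theorem add {f g : E → ℝ} (hf : BoundedSmooth f) (hg : BoundedSmooth g) :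
    BoundedSmooth fun x => f x + g x :=
  ⟨hf.1.add hg.1, hf.2.add hg.2, by
    have h : _root_.fderiv ℝ (fun x => f x + g x) =
        fun x => _root_.fderiv ℝ f x + _root_.fderiv ℝ g x :=
      funext fun x => fderiv_fun_add (hf.1 x) (hg.1 x)
    rw [h]
    exact hf.3.add hg.3⟩

theorem mul {f g : E → ℝ} (hf : BoundedSmooth f) (hg : BoundedSmooth g) :
    BoundedSmooth fun x => f x * g x :=
  ⟨hf.1.mul hg.1, hf.2.smul hg.2, by
    have h : _root_.fderiv ℝ (fun x => f x * g x) =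
        fun x => f x • _root_.fderiv ℝ g x + g x • _root_.fderiv ℝ f x :=
      funext fun x => fderiv_fun_mul (hf.1 x) (hg.1 x)
    rw [h]
    exact (hf.2.smul hg.3).add (hg.2.smul hf.3)⟩

theorem sum {ι : Type*} (s : Finset ι) {f : ι → E → ℝ} (hf : ∀ i, BoundedSmooth (f i)) :
    BoundedSmooth fun x => ∑ i ∈ s, f i x := by
  classical
  induction s using Finset.induction_on with
  | empty => simpa using const 0
  | insert i s hi ih => simpa only [Finset.sum_insert hi] using (hf i).add ih

theorem sin (l : E →L[ℝ] ℝ) : BoundedSmooth fun x => Real.sin (l x) :=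
  ⟨Real.differentiable_sin.comp l.differentiable, .sin l, by
    have h : _root_.fderiv ℝ (fun x => Real.sin (l x)) = fun x => Real.cos (l x) • l :=
      funext fun x => l.hasFDerivAt.sin.fderiv
    rw [h]
    exact (BoundedLipschitz.cos l).smul (.const l)⟩

theorem cos (l : E →L[ℝ] ℝ) : BoundedSmooth fun x => Real.cos (l x) :=
  ⟨Real.differentiable_cos.comp l.differentiable, .cos l, by
    have h : _root_.fderiv ℝ (fun x => Real.cos (l x)) = fun x => Real.sin (l x) • (-l) :=
      funext fun x => by rw [l.hasFDerivAt.cos.fderiv]; ext v; simp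
    rw [h]
    exact (BoundedLipschitz.sin l).smul (.const (-l))⟩

theorem normSq {f : E → ℂ} (hre : BoundedSmooth fun x => (f x).re)
    (him : BoundedSmooth fun x => (f x).im) : BoundedSmooth fun x => Complex.normSq (f x) := by
  simpa only [Complex.normSq_apply] using (hre.mul hre).add (him.mul him)

theorem normSq_sum_exp_mul {ι : Type*} (s : Finset ι) (l : ι → E →L[ℝ] ℝ) (c : ι → ℂ) :
    BoundedSmooth fun x =>
      Complex.normSq (∑ k ∈ s, Complex.exp (Complex.I * (l k x : ℂ)) * c k) := by
  have hexp (t : ℝ) : Complex.exp (Complex.I * (t : ℂ)) = ⟨Real.cos t, Real.sin t⟩ := by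
    apply Complex.ext <;> simp [Complex.exp_re, Complex.exp_im]
  refine normSq ?_ ?_
  · simp only [Complex.re_sum, hexp, Complex.mul_re]
    refine sum s fun k => ?_
    simpa only [sub_eq_add_neg, mul_neg] using
      ((cos (l k)).mul (const (c k).re)).add ((sin (l k)).mul (const (-(c k).im)))
  · simp only [Complex.im_sum, hexp, Complex.mul_im]
    exact sum s fun k =>
      ((cos (l k)).mul (const (c k).im)).add ((sin (l k)).mul (const (c k).re))

end BoundedSmooth

/-- `h(α,Φ) = Σ_θ (α P̄_θ − ‖X(Φ) a_θ‖²)²` with `X(Φ)_{i,m} = exp(j φ_{i,m})`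
is differentiable in `Φ`, and for every `α_max > 0` there is `L ≥ 0` such that
`∇_Φ h(α,·)` is `L`-Lipschitz uniformly in `α ∈ [0, α_max]` (Frobenius norm). -/
theorem stmt_3 {N M : ℕ} (hN : 0 < N) (hM : 0 < M)
    {ιΘ : Type*} (Θ : Finset ιΘ) (a : ιΘ → Fin M → ℂ) (P : ιΘ → ℝ)
    (X : EuclideanSpace ℝ (Fin N × Fin M) → Matrix (Fin N) (Fin M) ℂ)
    (hX : ∀ Φ i m, X Φ i m = Complex.exp (Complex.I * (Φ (i, m) : ℂ)))
    (h : ℝ → EuclideanSpace ℝ (Fin N × Fin M) → ℝ)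
    (hh : ∀ α Φ, h α Φ =
      ∑ θ ∈ Θ, (α * P θ - ∑ i, Complex.normSq ((X Φ).mulVec (a θ) i)) ^ 2) :
    (∀ α, Differentiable ℝ (h α)) ∧
    (∀ αmax : ℝ, 0 < αmax → ∃ L : ℝ, 0 ≤ L ∧
      ∀ α ∈ Set.Icc (0 : ℝ) αmax, ∀ Φ Φhat : EuclideanSpace ℝ (Fin N × Fin M),
        ‖gradient (h α) Φ - gradient (h α) Φhat‖ ≤ L * ‖Φ - Φhat‖) := by
  have hg (θ : ιΘ) :
      BoundedSmooth fun Φ => ∑ i, Complex.normSq ((X Φ).mulVec (a θ) i) := by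
    refine BoundedSmooth.sum _ fun i => ?_
    simp only [Matrix.mulVec, dotProduct, hX]
    let l (m : Fin M) : EuclideanSpace ℝ (Fin N × Fin M) →L[ℝ] ℝ := EuclideanSpace.proj (i, m)
    have hl (m : Fin M) (Φ) : Φ (i, m) = l m Φ := rfl
    simp only [hl]
    exact BoundedSmooth.normSq_sum_exp_mul Finset.univ l (a θ)
  obtain ⟨g, hgdef⟩ : ∃ g : ιΘ → EuclideanSpace ℝ (Fin N × Fin M) → ℝ,
      ∀ θ Φ, ∑ i, Complex.normSq ((X Φ).mulVec (a θ) i) = g θ Φ := ⟨_, fun _ _ => rfl⟩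
  simp only [hgdef] at hg hh
  obtain ⟨B, hBdef⟩ : ∃ B : EuclideanSpace ℝ (Fin N × Fin M) → ℝ,
      B = fun Φ => ∑ θ ∈ Θ, (-2 * P θ) * g θ Φ := ⟨_, rfl⟩
  obtain ⟨C, hCdef⟩ : ∃ C : EuclideanSpace ℝ (Fin N × Fin M) → ℝ,
      C = fun Φ => ∑ θ ∈ Θ, g θ Φ * g θ Φ := ⟨_, rfl⟩
  have hB : BoundedSmooth B :=
    hBdef ▸ BoundedSmooth.sum Θ fun θ => (BoundedSmooth.const _).mul (hg θ)
  have hC : BoundedSmooth C := hCdef ▸ BoundedSmooth.sum Θ fun θ => (hg θ).mul (hg θ)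
  have hexpand (α : ℝ) : h α = fun Φ => α ^ 2 * (∑ θ ∈ Θ, P θ ^ 2) + (α * B Φ + C Φ) := by
    funext Φ
    simp only [hh, hBdef, hCdef, Finset.mul_sum, ← Finset.sum_add_distrib]
    exact Finset.sum_congr rfl fun θ _ => by ring
  have hderiv (α : ℝ) (Φ) : HasFDerivAt (h α) (α • fderiv ℝ B Φ + fderiv ℝ C Φ) Φ := by
    rw [hexpand]
    exact (((hB.differentiable Φ).hasFDerivAt.const_mul α).add
      (hC.differentiable Φ).hasFDerivAt).const_add _
  refine ⟨fun α Φ => (hderiv α Φ).differentiableAt, fun αmax hα => ?_⟩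
  obtain ⟨K, hK, -, hBl⟩ := hB.fderiv
  obtain ⟨D, hD, -, hCl⟩ := hC.fderiv
  refine ⟨αmax * K + D, by positivity, fun α hα' Φ Φhat => ?_⟩
  rw [gradient, gradient, ← map_sub, LinearIsometryEquiv.norm_map, (hderiv α Φ).fderiv,
    (hderiv α Φhat).fderiv, add_sub_add_comm, ← smul_sub, add_mul, mul_assoc]
  refine norm_add_le_of_le ?_ (hCl Φ Φhat)
  rw [norm_smul, Real.norm_of_nonneg hα'.1]
  exact mul_le_mul hα'.2 (hBl Φ Φhat) (norm_nonneg _) hα.le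
end

section
/- Let n be an integer with 0 ≤ n ≤ N, let I be a finite index set, and for each i ∈ I let a_i, b_i ∈ ℂ^M and w_i ∈ ℝ. Define f : ℝ^{N×M} → ℝ by f(Φ) = Σ_{i∈I} w_i² |a_i^H X(Φ)^H S_n X(Φ) b_i|². Then f is differentiable on ℝ^{N×M}, and there exists a constant L_n ≥ 0 such that ‖∇f(Φ) − ∇f(Φ̂)‖_F ≤ L_n ‖Φ − Φ̂‖_F for all Φ, Φ̂ ∈ ℝ^{N×M}, where ‖·‖_F denotes the Frobenius norm. -/
open Matrix

section

variable {E G H : Type*} [NormedAddCommGroup E] [NormedSpace ℝ E]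
  [NormedAddCommGroup G] [NormedSpace ℝ G] [NormedAddCommGroup H] [NormedSpace ℝ H]

/-- `F` is bounded and differentiable, with bounded and Lipschitz derivative. -/
def BoundedLipschitzDeriv (F : E → G) : Prop :=
  Differentiable ℝ F ∧ ∃ C : ℝ, 0 ≤ C ∧ (∀ x, ‖F x‖ ≤ C) ∧ (∀ x, ‖fderiv ℝ F x‖ ≤ C) ∧
    ∀ x y, ‖fderiv ℝ F x - fderiv ℝ F y‖ ≤ C * ‖x - y‖

theorem norm_sub_le_of_norm_fderiv_le {F : E → G} (hF : Differentiable ℝ F) {C : ℝ}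
    (hC : ∀ x, ‖fderiv ℝ F x‖ ≤ C) (x y : E) : ‖F x - F y‖ ≤ C * ‖x - y‖ :=
  convex_univ.norm_image_sub_le_of_norm_fderiv_le (𝕜 := ℝ) (fun z _ => hF z)
    (fun z _ => hC z) (Set.mem_univ y) (Set.mem_univ x)

namespace BoundedLipschitzDeriv

theorem const (c : G) : BoundedLipschitzDeriv (fun _ : E => c) := by
  refine ⟨differentiable_const c, ‖c‖, norm_nonneg c, fun _ => le_rfl, fun x => ?_, fun x y => ?_⟩
  · simp
  · simpa using by positivity

theorem add {F K : E → G} (hF : BoundedLipschitzDeriv F) (hK : BoundedLipschitzDeriv K) :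
    BoundedLipschitzDeriv (fun x => F x + K x) := by
  obtain ⟨dF, A, hA, fA, gA, lA⟩ := hF
  obtain ⟨dK, B, hB, fB, gB, lB⟩ := hK
  have hd (x : E) : fderiv ℝ (fun x => F x + K x) x = fderiv ℝ F x + fderiv ℝ K x :=
    fderiv_fun_add (dF x) (dK x)
  refine ⟨dF.add dK, A + B, by positivity, fun x => norm_add_le_of_le (fA x) (fB x),
    fun x => ?_, fun x y => ?_⟩
  · rw [hd]
    exact norm_add_le_of_le (gA x) (gB x)
  · rw [hd, hd, add_sub_add_comm, add_mul]
    exact norm_add_le_of_le (lA x y) (lB x y)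

theorem sum {ι : Type*} (s : Finset ι) {F : ι → E → G}
    (hF : ∀ i ∈ s, BoundedLipschitzDeriv (F i)) :
    BoundedLipschitzDeriv (fun x => ∑ i ∈ s, F i x) := by
  classical
  induction s using Finset.induction_on with
  | empty => simpa using const (E := E) (0 : G)
  | insert i s hi ih =>
    simp only [Finset.sum_insert hi]
    exact (hF i (by simp)).add (ih fun j hj => hF j (by simp [hj]))

theorem clm_comp (L : G →L[ℝ] H) {F : E → G} (hF : BoundedLipschitzDeriv F) :
    BoundedLipschitzDeriv (fun x => L (F x)) := by
  obtain ⟨dF, A, hA, fA, gA, lA⟩ := hF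
  have hd (x : E) : fderiv ℝ (fun x => L (F x)) x = L.comp (fderiv ℝ F x) :=
    (L.hasFDerivAt.comp x (dF x).hasFDerivAt).fderiv
  refine ⟨L.differentiable.comp dF, ‖L‖ * A, by positivity, fun x => L.le_opNorm_of_le (fA x),
    fun x => ?_, fun x y => ?_⟩
  · rw [hd]
    exact (L.opNorm_comp_le _).trans (by gcongr; exact gA x)
  · rw [hd, hd, ← ContinuousLinearMap.comp_sub, mul_assoc]
    exact (L.opNorm_comp_le _).trans (by gcongr; exact lA x y)

theorem mul {F K : E → ℂ} (hF : BoundedLipschitzDeriv F) (hK : BoundedLipschitzDeriv K) :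
    BoundedLipschitzDeriv (fun x => F x * K x) := by
  obtain ⟨dF, A, hA, fA, gA, lA⟩ := hF
  obtain ⟨dK, B, hB, fB, gB, lB⟩ := hK
  have hd (x : E) : fderiv ℝ (fun x => F x * K x) x = F x • fderiv ℝ K x + K x • fderiv ℝ F x :=
    fderiv_fun_mul (dF x) (dK x)
  have smul_bound {u : ℂ} {v : E →L[ℝ] ℂ} {p q : ℝ} (hp : 0 ≤ p) (hu : ‖u‖ ≤ p) (hv : ‖v‖ ≤ q) :
      ‖u • v‖ ≤ p * q := by
    rw [norm_smul]
    gcongr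
  refine ⟨dF.mul dK, 4 * (A * B), by positivity, fun x => ?_, fun x => ?_, fun x y => ?_⟩
  · rw [norm_mul]
    have : ‖F x‖ * ‖K x‖ ≤ A * B := by gcongr; exacts [fA x, fB x]
    nlinarith [mul_nonneg hA hB]
  · rw [hd]
    have := norm_add_le_of_le (smul_bound hA (fA x) (gB x)) (smul_bound hB (fB x) (gA x))
    nlinarith [mul_nonneg hA hB]
  · rw [hd, hd]
    have key : F x • fderiv ℝ K x + K x • fderiv ℝ F x - (F y • fderiv ℝ K y + K y • fderiv ℝ F y) =
        F x • (fderiv ℝ K x - fderiv ℝ K y) + (F x - F y) • fderiv ℝ K y +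
        (K x • (fderiv ℝ F x - fderiv ℝ F y) + (K x - K y) • fderiv ℝ F y) := by
      ext z
      simp
      ring
    rw [key]
    have hxy := norm_nonneg (x - y)
    refine (norm_add_le_of_le
      (norm_add_le_of_le (smul_bound hA (fA x) (lB x y))
        (smul_bound (by positivity) (norm_sub_le_of_norm_fderiv_le dF gA x y) (gB y)))
      (norm_add_le_of_le (smul_bound hB (fB x) (lA x y))
        (smul_bound (by positivity) (norm_sub_le_of_norm_fderiv_le dK gB x y) (gA y)))).trans
      (le_of_eq (by ring))

theorem cexp_I_mul (L : E →L[ℝ] ℝ) :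
    BoundedLipschitzDeriv (fun x => Complex.exp (Complex.I * (L x : ℂ))) := by
  set T : E →L[ℝ] ℂ := Complex.I • Complex.ofRealCLM.comp L
  have hnorm (x : E) : ‖Complex.exp (Complex.I * (L x : ℂ))‖ = 1 := by
    rw [mul_comm, Complex.norm_exp_ofReal_mul_I]
  have hder (x : E) : HasFDerivAt (fun x => Complex.exp (Complex.I * (L x : ℂ)))
      (Complex.exp (Complex.I * (L x : ℂ)) • T) x :=
    T.hasFDerivAt.cexp
  have hdiff : Differentiable ℝ (fun x => Complex.exp (Complex.I * (L x : ℂ))) :=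
    fun x => (hder x).differentiableAt
  have hbound (x : E) : ‖fderiv ℝ (fun x => Complex.exp (Complex.I * (L x : ℂ))) x‖ ≤ ‖T‖ := by
    rw [(hder x).fderiv, norm_smul, hnorm, one_mul]
  refine ⟨hdiff, 1 + ‖T‖ + ‖T‖ * ‖T‖, by positivity, fun x => ?_, fun x => ?_, fun x y => ?_⟩
  · rw [hnorm]
    nlinarith [norm_nonneg T]
  · nlinarith [norm_nonneg T, hbound x]
  · rw [(hder x).fderiv, (hder y).fderiv, ← sub_smul, norm_smul]
    calc _ ≤ ‖T‖ * ‖x - y‖ * ‖T‖ := by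
          gcongr
          exact norm_sub_le_of_norm_fderiv_le hdiff hbound x y
      _ = ‖T‖ * ‖T‖ * ‖x - y‖ := by ring
      _ ≤ _ := by
          gcongr
          linarith [norm_nonneg T]

theorem star {F : E → ℂ} (hF : BoundedLipschitzDeriv F) :
    BoundedLipschitzDeriv (fun x => star (F x)) :=
  hF.clm_comp (Complex.conjCLE : ℂ →L[ℝ] ℂ)

theorem normSq {F : E → ℂ} (hF : BoundedLipschitzDeriv F) :
    BoundedLipschitzDeriv (fun x => Complex.normSq (F x)) := by
  have h := (hF.mul hF.star).clm_comp Complex.reCLM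
  convert h using 2 with x
  simp [Complex.normSq_apply]

end BoundedLipschitzDeriv

end

/-- `f(Φ) = Σ_{i∈I} w_i² |a_iᴴ X(Φ)ᴴ S_n X(Φ) b_i|²` with
`X(Φ)_{i,m} = exp(j φ_{i,m})` is differentiable, and its gradient is Lipschitz
continuous with some constant `L_n ≥ 0` (Frobenius norm). -/
theorem stmt_4 {N M : ℕ} (hN : 0 < N) (hM : 0 < M) (n : ℕ) (hn : n ≤ N)
    {ιI : Type*} (I : Finset ιI)
    (a b : ιI → Fin M → ℂ) (w : ιI → ℝ)
    (S : Matrix (Fin N) (Fin N) ℂ)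
    (hS : ∀ p q : Fin N, S p q = if (q : ℕ) = (p : ℕ) + n then 1 else 0)
    (X : EuclideanSpace ℝ (Fin N × Fin M) → Matrix (Fin N) (Fin M) ℂ)
    (hX : ∀ Φ i m, X Φ i m = Complex.exp (Complex.I * (Φ (i, m) : ℂ)))
    (f : EuclideanSpace ℝ (Fin N × Fin M) → ℝ)
    (hf : ∀ Φ, f Φ =
      ∑ i ∈ I, (w i) ^ 2 *
        Complex.normSq (star (a i) ⬝ᵥ ((X Φ)ᴴ * S * X Φ).mulVec (b i))) :
    Differentiable ℝ f ∧
    ∃ Ln : ℝ, 0 ≤ Ln ∧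
      ∀ Φ Φhat : EuclideanSpace ℝ (Fin N × Fin M),
        ‖gradient f Φ - gradient f Φhat‖ ≤ Ln * ‖Φ - Φhat‖ := by
  have hXB (i : Fin N) (m : Fin M) : BoundedLipschitzDeriv (fun Φ => X Φ i m) := by
    simp only [hX]
    exact .cexp_I_mul (EuclideanSpace.proj (𝕜 := ℝ) (i, m))
  have hfB : BoundedLipschitzDeriv f := by
    rw [funext hf]
    refine .sum _ fun i _ => .clm_comp ((w i ^ 2) • ContinuousLinearMap.id ℝ ℝ) (.normSq ?_)
    simp only [dotProduct, mulVec, Matrix.mul_apply, conjTranspose_apply]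
    exact .sum _ fun k _ => .mul (.const _) <| .sum _ fun l _ => .mul
      (.sum _ fun p _ => .mul (.sum _ fun q _ => .mul (hXB q k).star (.const _)) (hXB p l))
      (.const _)
  obtain ⟨hd, C, hC, -, -, hLip⟩ := hfB
  refine ⟨hd, C, hC, fun Φ Φhat => ?_⟩
  rw [gradient, gradient, ← map_sub, LinearIsometryEquiv.norm_map]
  exact hLip Φ Φhat
end

section
/- Consider one consensus-ADMM iteration under the following assumptions: L_α > 0, L > 0; h satisfies the joint descent inequality h(α',Φ') ≤ h(α,Φ) + ∂_αh(α,Φ)·(α'−α) + ⟨∇_Φh(α,Φ), Φ'−Φ⟩ + (L_α/2)(α'−α)² + (L/2)‖Φ'−Φ‖² for all (α,Φ), (α',Φ'); for every n ∈ T, f_n has L_n-Lipschitz gradient with L_n > 0 and ρ_n > 0; the current multipliers satisfy Λ_n^k = −∇f_n(Φ^k) − L_n(Φ_n^k − Φ^k) for every n ∈ T; (α^k, Φ^k) ∈ C; (α^{k+1}, Φ^{k+1}) lies in C and minimizes the surrogate U^k over C; and Φ_n^{k+1} = Φ^{k+1} − (∇f_n(Φ^{k+1}) + Λ_n^k)/(ρ_n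 + L_n), Λ_n^{k+1} = Λ_n^k + ρ_n(Φ_n^{k+1} − Φ^{k+1}). Set c̄_n = ρ_n³ − 7ρ_n²L_n − 8ρ_nL_n² − 32L_n³ and c̃_n = ρ_n³ − 12ρ_nL_n² − 48L_n³. Then the augmented Lagrangian decreases sufficiently: 𝓛(α^k, Φ^k, {Φ_n^k, Λ_n^k}) − 𝓛(α^{k+1}, Φ^{k+1}, {Φ_n^{k+1}, Λ_n^{k+1}}) ≥ Σ_{n∈T} (1/(2ρ_n²)) (c̄_n ‖Φ_n^{k+1} − Φ_n^k‖² + c̃_n ‖Φ^{k+1} − Φ^k‖²) + (L/2)‖Φ^{k+1} − Φ^k‖² + (L_α/2)(α^{k+1} − α^k)². -/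
open RealInnerProductSpace

/-- Lower quadratic bound for a function with `K`-Lipschitz gradient. -/
theorem quadratic_lower_bound_of_lipschitz_gradient {E : Type*} [NormedAddCommGroup E]
    [InnerProductSpace ℝ E] {f : E → ℝ} {f' : E → E} {K : ℝ}
    (hgrad : ∀ x, HasFDerivAt f (InnerProductSpace.toDualMap ℝ E (f' x)) x)
    (hLip : ∀ x y, ‖f' x - f' y‖ ≤ K * ‖x - y‖) (x v : E) :
    f x + ⟪f' x, v⟫ - K / 2 * ‖v‖ ^ 2 ≤ f (x + v) := by
  have hd : ∀ t : ℝ, HasDerivAt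
      (fun t : ℝ => f (x + t • v) - t * ⟪f' x, v⟫ + K / 2 * ‖v‖ ^ 2 * t ^ 2)
      (⟪f' (x + t • v) - f' x, v⟫ + K * ‖v‖ ^ 2 * t) t := by
    intro t
    have hline : HasDerivAt (fun t : ℝ => x + t • v) v t := by
      simpa using ((hasDerivAt_id t).smul_const v).const_add x
    have hf : HasDerivAt (fun t : ℝ => f (x + t • v)) ⟪f' (x + t • v), v⟫ t := by
      have hcomp := (hgrad (x + t • v)).comp_hasDerivAt t hline
      rwa [InnerProductSpace.toDualMap_apply_apply] at hcomp
    have hlin : HasDerivAt (fun t : ℝ => t * ⟪f' x, v⟫) ⟪f' x, v⟫ t := by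
      simpa using (hasDerivAt_id t).mul_const ⟪f' x, v⟫
    have hsq : HasDerivAt (fun t : ℝ => K / 2 * ‖v‖ ^ 2 * t ^ 2)
        (K / 2 * ‖v‖ ^ 2 * (2 * t)) t := by
      simpa using (hasDerivAt_pow 2 t).const_mul (K / 2 * ‖v‖ ^ 2)
    refine ((hf.sub hlin).add hsq).congr_deriv ?_
    rw [inner_sub_left]
    ring
  have hmono := monotoneOn_of_deriv_nonneg (convex_Ici (0 : ℝ))
    (fun t _ => (hd t).continuousAt.continuousWithinAt)
    (fun t _ => (hd t).differentiableAt.differentiableWithinAt) (by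
      intro t ht
      rw [interior_Ici] at ht
      have ht : 0 < t := ht
      rw [(hd t).deriv]
      have hinner := abs_le.mp (abs_real_inner_le_norm (f' (x + t • v) - f' x) v)
      have hnorm := hLip (x + t • v) x
      rw [add_sub_cancel_left, norm_smul, Real.norm_of_nonneg ht.le] at hnorm
      nlinarith [mul_le_mul_of_nonneg_right hnorm (norm_nonneg v), hinner.1])
  have h01 := hmono (Set.mem_Ici.mpr le_rfl) (Set.mem_Ici.mpr zero_le_one) zero_le_one
  simp only [zero_smul, one_smul, add_zero] at h01
  linarith

/-- If a quadratic polynomial with leading coefficient `A` is minimal at `0` on `[0, 1]`, then it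
grows by at least `A` from `0` to `1`. -/
theorem le_sub_of_quadratic_min {φ : ℝ → ℝ} {A : ℝ}
    (hquad : ∀ t, φ t = φ 0 + t * (φ 1 - φ 0 - A) + t ^ 2 * A)
    (hmin : ∀ t ∈ Set.Icc (0 : ℝ) 1, φ 0 ≤ φ t) : A ≤ φ 1 - φ 0 := by
  by_contra! hlt
  have hA : 0 < A := by linarith [hmin 1 ⟨zero_le_one, le_rfl⟩]
  have hgap : 0 < A - (φ 1 - φ 0) := by linarith
  have hle : A - (φ 1 - φ 0) ≤ A := by linarith [hmin 1 ⟨zero_le_one, le_rfl⟩]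
  set t := (A - (φ 1 - φ 0)) / (2 * A) with ht
  have ht0 : 0 < t := by positivity
  have ht1 : t ≤ 1 := by
    rw [ht, div_le_one (by positivity)]
    linarith
  have htA : t * A = (A - (φ 1 - φ 0)) / 2 := by
    rw [ht]
    field_simp
  have := hmin t ⟨ht0.le, ht1⟩
  rw [hquad t] at this
  nlinarith [mul_pos ht0 hgap]

/-- A penalty term is quadratic along a line. -/
theorem penalty_line_expansion {E : Type*} [NormedAddCommGroup E] [InnerProductSpace ℝ E]
    (l x y D : E) (r t : ℝ) :
    ⟪l, x - (y + t • D)⟫ + r / 2 * ‖x - (y + t • D)‖ ^ 2 =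
      (⟪l, x - y⟫ + r / 2 * ‖x - y‖ ^ 2)
        + t * ((⟪l, x - (y + D)⟫ + r / 2 * ‖x - (y + D)‖ ^ 2)
          - (⟪l, x - y⟫ + r / 2 * ‖x - y‖ ^ 2) - r / 2 * ‖D‖ ^ 2)
        + t ^ 2 * (r / 2 * ‖D‖ ^ 2) := by
  have hsub : ∀ s : ℝ, x - (y + s • D) = (x - y) - s • D := fun s => by abel
  rw [hsub t, show x - (y + D) = (x - y) - D by abel]
  simp only [norm_sub_sq_real, inner_sub_right, inner_smul_right, norm_smul, mul_pow,
    Real.norm_eq_abs, sq_abs]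
  ring

/-- Decrease of one local penalized term when the consensus point moves from `y` to `y'`,
the local variable from `x` to `x'` and the multiplier from `l` to `l'`. -/
theorem local_term_decrease {E : Type*} [NormedAddCommGroup E] [InnerProductSpace ℝ E]
    {f : E → ℝ} {f' : E → E} {K r : ℝ} (hK : 0 < K) (hr : 0 < r)
    (hgrad : ∀ x, HasFDerivAt f (InnerProductSpace.toDualMap ℝ E (f' x)) x)
    (hLip : ∀ x y, ‖f' x - f' y‖ ≤ K * ‖x - y‖) {x y x' y' l l' : E}
    (hl : l = -f' y - K • (x - y)) (hx' : x' = y' - (r + K)⁻¹ • (f' y' + l))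
    (hl' : l' = l + r • (x' - y')) :
    1 / (2 * r ^ 2) *
        ((r ^ 3 - 7 * r ^ 2 * K - 8 * r * K ^ 2 - 32 * K ^ 3) * ‖x' - x‖ ^ 2
          + (r ^ 3 - 12 * r * K ^ 2 - 48 * K ^ 3) * ‖y' - y‖ ^ 2)
      ≤ r / 2 * ‖y' - y‖ ^ 2 + (f x + ⟪l, x - y'⟫ + r / 2 * ‖x - y'‖ ^ 2)
        - (f x' + ⟪l', x' - y'⟫ + r / 2 * ‖x' - y'‖ ^ 2) := by
  have hstat : l' = -f' y' - K • (x' - y') := by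
    have hscale : (r + K) • (x' - y') = -(f' y' + l) := by
      rw [hx', sub_sub_cancel_left, smul_neg, smul_inv_smul₀ (by positivity)]
    rw [add_smul] at hscale
    rw [hl', eq_sub_iff_add_eq, add_assoc, hscale]
    abel
  have hru : r • (x' - y') = -(f' y' - f' y) - K • ((x' - x) - (y' - y)) := by
    have : r • (x' - y') = l' - l := by rw [hl', add_sub_cancel_left]
    rw [this, hstat, hl]
    module
  have hu : r * ‖x' - y'‖ ≤ K * (2 * ‖y' - y‖ + ‖x' - x‖) := by
    calc r * ‖x' - y'‖ = ‖r • (x' - y')‖ := by rw [norm_smul, Real.norm_of_nonneg hr.le]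
      _ ≤ ‖f' y' - f' y‖ + K * ‖(x' - x) - (y' - y)‖ := by
          rw [hru]
          refine (norm_sub_le _ _).trans_eq ?_
          rw [norm_neg, norm_smul, Real.norm_of_nonneg hK.le]
      _ ≤ K * ‖y' - y‖ + K * (‖x' - x‖ + ‖y' - y‖) := by
          gcongr
          · exact hLip y' y
          · exact norm_sub_le _ _
      _ = K * (2 * ‖y' - y‖ + ‖x' - x‖) := by ring
  have hdesc := quadratic_lower_bound_of_lipschitz_gradient hgrad hLip x' (x - x')
  rw [add_sub_cancel, norm_sub_rev x x', ← neg_sub x' x, inner_neg_right] at hdesc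
  have hcross : ⟪f' x' + l', x' - x⟫ ≤ 2 * K * ‖x' - y'‖ * ‖x' - x‖ := by
    refine (real_inner_le_norm _ _).trans ?_
    gcongr
    calc ‖f' x' + l'‖ = ‖(f' x' - f' y') - K • (x' - y')‖ := by
          rw [hstat]
          congr 1
          abel
      _ ≤ ‖f' x' - f' y'‖ + ‖K • (x' - y')‖ := norm_sub_le _ _
      _ ≤ 2 * K * ‖x' - y'‖ := by
          rw [norm_smul, Real.norm_of_nonneg hK.le]
          linarith [hLip x' y']
  rw [inner_add_left] at hcross
  have hpen : ⟪l, x - y'⟫ + r / 2 * ‖x - y'‖ ^ 2 - ⟪l', x' - y'⟫ - r / 2 * ‖x' - y'‖ ^ 2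
      = r / 2 * ‖x' - x‖ ^ 2 - r * ‖x' - y'‖ ^ 2 - ⟪l', x' - x⟫ := by
    rw [hl', show x - y' = (x' - y') - (x' - x) by abel, norm_sub_sq_real, inner_sub_right,
      inner_add_left, inner_add_left, real_inner_smul_left, real_inner_smul_left,
      real_inner_self_eq_norm_sq]
    ring
  have hsq : (r * ‖x' - y'‖) ^ 2 ≤ K ^ 2 * (6 * ‖y' - y‖ ^ 2 + 3 * ‖x' - x‖ ^ 2) := by
    calc (r * ‖x' - y'‖) ^ 2 ≤ (K * (2 * ‖y' - y‖ + ‖x' - x‖)) ^ 2 := by gcongr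
      _ ≤ K ^ 2 * (6 * ‖y' - y‖ ^ 2 + 3 * ‖x' - x‖ ^ 2) := by
          rw [mul_pow]
          gcongr
          nlinarith [sq_nonneg (‖y' - y‖ - ‖x' - x‖)]
  have hbound : r * ‖x' - y'‖ ^ 2 + K / 2 * ‖x' - x‖ ^ 2 + 2 * K * ‖x' - y'‖ * ‖x' - x‖
      ≤ r / 2 * ‖y' - y‖ ^ 2 + r / 2 * ‖x' - x‖ ^ 2 - 1 / (2 * r ^ 2) *
        ((r ^ 3 - 7 * r ^ 2 * K - 8 * r * K ^ 2 - 32 * K ^ 3) * ‖x' - x‖ ^ 2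
          + (r ^ 3 - 12 * r * K ^ 2 - 48 * K ^ 3) * ‖y' - y‖ ^ 2) := by
    generalize ‖x' - y'‖ = u at hsq ⊢
    generalize ‖x' - x‖ = d at hsq ⊢
    generalize ‖y' - y‖ = e at hsq ⊢
    rw [← mul_le_mul_iff_right₀ (show 0 < 2 * r ^ 2 by positivity)]
    have hexp : 2 * r ^ 2 * (r / 2 * e ^ 2 + r / 2 * d ^ 2 - 1 / (2 * r ^ 2) *
        ((r ^ 3 - 7 * r ^ 2 * K - 8 * r * K ^ 2 - 32 * K ^ 3) * d ^ 2
          + (r ^ 3 - 12 * r * K ^ 2 - 48 * K ^ 3) * e ^ 2))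
        = (7 * r ^ 2 * K + 8 * r * K ^ 2 + 32 * K ^ 3) * d ^ 2
          + (12 * r * K ^ 2 + 48 * K ^ 3) * e ^ 2 := by
      field_simp
      ring
    rw [hexp]
    have h1 := mul_le_mul_of_nonneg_left hsq hr.le
    have h2 := mul_le_mul_of_nonneg_left hsq hK.le
    have h3 : 0 ≤ K * r ^ 2 * (u - d) ^ 2 := by positivity
    have h4 : 0 ≤ K * r ^ 2 * d ^ 2 := by positivity
    have h5 : 0 ≤ r * K ^ 2 * d ^ 2 := by positivity
    have h6 : 0 ≤ K ^ 3 * d ^ 2 := by positivity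
    have h7 : 0 ≤ K ^ 3 * e ^ 2 := by positivity
    linarith
  linarith

/-- One consensus-ADMM iteration decreases the augmented Lagrangian
sufficiently:
`𝓛(α^k, Φ^k, {Φ_n^k, Λ_n^k}) − 𝓛(α^{k+1}, Φ^{k+1}, {Φ_n^{k+1}, Λ_n^{k+1}})
 ≥ Σ_n (1/(2ρ_n²)) (c̄_n ‖Φ_n^{k+1} − Φ_n^k‖² + c̃_n ‖Φ^{k+1} − Φ^k‖²)
 + (L/2)‖Φ^{k+1} − Φ^k‖² + (L_α/2)(α^{k+1} − α^k)²`. -/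
theorem stmt_7 {E : Type*} [NormedAddCommGroup E] [InnerProductSpace ℝ E]
    {ι : Type*} (T : Finset ι)
    (h : ℝ × E → ℝ) (dah : ℝ × E → ℝ) (dΦh : ℝ × E → E)
    (hda : ∀ α (Φ : E), HasDerivAt (fun t => h (t, Φ)) (dah (α, Φ)) α)
    (hdΦ : ∀ α (Φ : E),
      HasFDerivAt (fun x => h (α, x)) (InnerProductSpace.toDualMap ℝ E (dΦh (α, Φ))) Φ)
    (Lα L : ℝ) (hLα : 0 < Lα) (hL : 0 < L)
    (hdesc : ∀ (α : ℝ) (Φ : E) (α' : ℝ) (Φ' : E),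
      h (α', Φ') ≤ h (α, Φ) + dah (α, Φ) * (α' - α) + ⟪dΦh (α, Φ), Φ' - Φ⟫
        + Lα / 2 * (α' - α) ^ 2 + L / 2 * ‖Φ' - Φ‖ ^ 2)
    (f : ι → E → ℝ) (f' : ι → E → E)
    (hgrad : ∀ n ∈ T, ∀ x, HasFDerivAt (f n) (InnerProductSpace.toDualMap ℝ E (f' n x)) x)
    (Ln : ι → ℝ) (hLn : ∀ n ∈ T, 0 < Ln n)
    (hLip : ∀ n ∈ T, ∀ x y, ‖f' n x - f' n y‖ ≤ Ln n * ‖x - y‖)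
    (ρ : ι → ℝ) (hρ : ∀ n ∈ T, 0 < ρ n)
    (C : Set (ℝ × E)) (hC : Convex ℝ C)
    (αk αk1 : ℝ) (Φk Φk1 : E) (Φnk Λnk Φnk1 Λnk1 : ι → E)
    (hΛk : ∀ n ∈ T, Λnk n = -f' n Φk - Ln n • (Φnk n - Φk))
    (hmemk : (αk, Φk) ∈ C) (hmemk1 : (αk1, Φk1) ∈ C)
    (hmin : ∀ p ∈ C,
      h (αk, Φk) + dah (αk, Φk) * (αk1 - αk) + ⟪dΦh (αk, Φk), Φk1 - Φk⟫
          + Lα / 2 * (αk1 - αk) ^ 2 + L / 2 * ‖Φk1 - Φk‖ ^ 2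
          + ∑ n ∈ T, (f n (Φnk n) + ⟪Λnk n, Φnk n - Φk1⟫ + ρ n / 2 * ‖Φnk n - Φk1‖ ^ 2)
        ≤ h (αk, Φk) + dah (αk, Φk) * (p.1 - αk) + ⟪dΦh (αk, Φk), p.2 - Φk⟫
          + Lα / 2 * (p.1 - αk) ^ 2 + L / 2 * ‖p.2 - Φk‖ ^ 2
          + ∑ n ∈ T, (f n (Φnk n) + ⟪Λnk n, Φnk n - p.2⟫ + ρ n / 2 * ‖Φnk n - p.2‖ ^ 2))
    (hupΦ : ∀ n ∈ T, Φnk1 n = Φk1 - (ρ n + Ln n)⁻¹ • (f' n Φk1 + Λnk n))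
    (hupΛ : ∀ n ∈ T, Λnk1 n = Λnk n + ρ n • (Φnk1 n - Φk1)) :
    ∑ n ∈ T, 1 / (2 * ρ n ^ 2) *
        ((ρ n ^ 3 - 7 * ρ n ^ 2 * Ln n - 8 * ρ n * Ln n ^ 2 - 32 * Ln n ^ 3) *
            ‖Φnk1 n - Φnk n‖ ^ 2
          + (ρ n ^ 3 - 12 * ρ n * Ln n ^ 2 - 48 * Ln n ^ 3) * ‖Φk1 - Φk‖ ^ 2)
      + L / 2 * ‖Φk1 - Φk‖ ^ 2 + Lα / 2 * (αk1 - αk) ^ 2 ≤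
    (h (αk, Φk) +
        ∑ n ∈ T, (f n (Φnk n) + ⟪Λnk n, Φnk n - Φk⟫ + ρ n / 2 * ‖Φnk n - Φk‖ ^ 2))
      - (h (αk1, Φk1) +
        ∑ n ∈ T, (f n (Φnk1 n) + ⟪Λnk1 n, Φnk1 n - Φk1⟫ + ρ n / 2 * ‖Φnk1 n - Φk1‖ ^ 2)) := by
  set D := Φk - Φk1 with hD
  set δ := αk - αk1 with hδ
  have hΦ : Φk1 + D = Φk := by rw [hD, add_sub_cancel]
  set S : E → ℝ := fun y =>
    ∑ n ∈ T, (f n (Φnk n) + ⟪Λnk n, Φnk n - y⟫ + ρ n / 2 * ‖Φnk n - y‖ ^ 2) with hS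
  set R := ∑ n ∈ T, ρ n / 2 * ‖D‖ ^ 2 with hR
  have hSline : ∀ t : ℝ, S (Φk1 + t • D) = S Φk1 + t * (S Φk - S Φk1 - R) + t ^ 2 * R := by
    intro t
    simp only [hS, hR, ← Finset.sum_sub_distrib, Finset.mul_sum, ← Finset.sum_add_distrib]
    refine Finset.sum_congr rfl fun n _ => ?_
    have := penalty_line_expansion (Λnk n) (Φnk n) Φk1 D (ρ n) t
    rw [hΦ] at this
    linear_combination this
  have hgrowth : Lα / 2 * δ ^ 2 + L / 2 * ‖D‖ ^ 2 + R ≤ (h (αk, Φk) + S Φk)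
      - (h (αk, Φk) + dah (αk, Φk) * (αk1 - αk) + ⟪dΦh (αk, Φk), Φk1 - Φk⟫
        + Lα / 2 * (αk1 - αk) ^ 2 + L / 2 * ‖Φk1 - Φk‖ ^ 2 + S Φk1) := by
    have hshift : ∀ t : ℝ, Φk1 + t • D - Φk = -((1 - t) • D) := fun t => by
      rw [← hΦ]
      module
    have hline : ∀ t : ℝ,
        h (αk, Φk) + dah (αk, Φk) * (αk1 + t * δ - αk) + ⟪dΦh (αk, Φk), Φk1 + t • D - Φk⟫
          + Lα / 2 * (αk1 + t * δ - αk) ^ 2 + L / 2 * ‖Φk1 + t • D - Φk‖ ^ 2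
          + S (Φk1 + t • D)
        = h (αk, Φk) - (1 - t) * (dah (αk, Φk) * δ + ⟪dΦh (αk, Φk), D⟫)
          + (1 - t) ^ 2 * (Lα / 2 * δ ^ 2 + L / 2 * ‖D‖ ^ 2)
          + (S Φk1 + t * (S Φk - S Φk1 - R) + t ^ 2 * R) := by
      intro t
      rw [hSline, hshift, norm_neg, norm_smul, mul_pow, Real.norm_eq_abs, sq_abs,
        inner_neg_right, inner_smul_right, hδ]
      ring
    have hcore := le_sub_of_quadratic_min (A := Lα / 2 * δ ^ 2 + L / 2 * ‖D‖ ^ 2 + R)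
      (φ := fun t : ℝ => h (αk, Φk) + dah (αk, Φk) * (αk1 + t * δ - αk)
          + ⟪dΦh (αk, Φk), Φk1 + t • D - Φk⟫
          + Lα / 2 * (αk1 + t * δ - αk) ^ 2 + L / 2 * ‖Φk1 + t • D - Φk‖ ^ 2
          + S (Φk1 + t • D))
      (fun t => by
        simp only [hline]
        ring)
      (fun t ht => by
        have hmem := hC.add_smul_sub_mem hmemk1 hmemk ht
        have hle := hmin _ hmem
        simpa [hS, hD, hδ] using hle)
    simpa [hΦ, hδ] using hcore
  have hlocal := Finset.sum_le_sum fun n hn => local_term_decrease (hLn n hn) (hρ n hn)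
    (hgrad n hn) (hLip n hn) (hΛk n hn) (hupΦ n hn) (hupΛ n hn)
  rw [Finset.sum_sub_distrib, Finset.sum_add_distrib] at hlocal
  have hdk := hdesc αk Φk αk1 Φk1
  have hnorm : ‖D‖ = ‖Φk1 - Φk‖ := norm_sub_rev _ _
  have hsqδ : δ ^ 2 = (αk1 - αk) ^ 2 := by
    rw [hδ]
    ring
  rw [hsqδ, hR, hnorm] at hgrowth
  simp only [hS] at hgrowth
  linarith
end

section
/- Let T be a finite index set, let h : ℝ × E → ℝ satisfy h ≥ 0, and for each n ∈ T let f_n : E → ℝ be differentiable with L_n-Lipschitz gradient and f_n ≥ 0, and let ρ_n ≥ 5L_n. Let α ∈ ℝ and Φ, Φ_n ∈ E for n ∈ T, and suppose Λ_n = −∇f_n(Φ) − L_n(Φ_n − Φ) for every n ∈ T. Then the augmented Lagrangian satisfies 𝓛(α, Φ, {Φ_n, Λ_n}) = h(α,Φ) + Σ_{n∈T} [f_n(Φ_n) + ⟨Λ_n, Φ_n − Φ⟩ + (ρ_n/2)‖Φ_n − Φ‖²] ≥ h(α,Φ) + Σ_{n∈T} [f_n(Φ) + ((ρ_n − 5L_n)/2)‖Φ_n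 − Φ‖²], and in particular 𝓛(α, Φ, {Φ_n, Λ_n}) ≥ 0. -/
open RealInnerProductSpace

/-- Quadratic lower bound for a function whose gradient is Lipschitz. -/
theorem sub_le_image_sub_of_lipschitz_gradient {E : Type*} [NormedAddCommGroup E]
    [InnerProductSpace ℝ E] {f : E → ℝ} {f' : E → E} {L : ℝ}
    (hf : ∀ x, HasFDerivAt f (InnerProductSpace.toDualMap ℝ E (f' x)) x)
    (hL : ∀ x y, ‖f' x - f' y‖ ≤ L * ‖x - y‖) (x d : E) :
    ⟪f' x, d⟫ - L / 2 * ‖d‖ ^ 2 ≤ f (x + d) - f x := by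
  have hline (t : ℝ) : HasDerivAt (fun t : ℝ => x + t • d) d t := by
    simpa using ((hasDerivAt_id t).smul_const d).const_add x
  have hderiv (t : ℝ) : HasDerivAt
      (fun t : ℝ => f (x + t • d) - t * ⟪f' x, d⟫ + t ^ 2 * (L / 2 * ‖d‖ ^ 2))
      (⟪f' (x + t • d), d⟫ - ⟪f' x, d⟫ + t * (L * ‖d‖ ^ 2)) t := by
    have h₁ : HasDerivAt (fun t : ℝ => f (x + t • d)) ⟪f' (x + t • d), d⟫ t := by
      have hcomp := (hf (x + t • d)).comp_hasDerivAt t (hline t)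
      rwa [InnerProductSpace.toDualMap_apply_apply] at hcomp
    refine ((h₁.sub ((hasDerivAt_id t).mul_const ⟪f' x, d⟫)).add
      ((hasDerivAt_pow 2 t).mul_const (L / 2 * ‖d‖ ^ 2))).congr_deriv ?_
    push_cast
    ring
  have hmono := monotoneOn_of_deriv_nonneg (convex_Icc (0 : ℝ) 1)
    (fun t _ => (hderiv t).continuousAt.continuousWithinAt)
    (fun t _ => (hderiv t).differentiableAt.differentiableWithinAt) (fun t ht => by
      rw [interior_Icc] at ht
      rw [(hderiv t).deriv, ← inner_sub_left]
      have hcs := neg_le_of_abs_le (abs_real_inner_le_norm (f' (x + t • d) - f' x) d)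
      have hlip := hL (x + t • d) x
      rw [add_sub_cancel_left, norm_smul, Real.norm_of_nonneg ht.1.le] at hlip
      have := mul_le_mul_of_nonneg_right hlip (norm_nonneg d)
      linarith)
  have h01 := hmono (Set.left_mem_Icc.2 zero_le_one) (Set.right_mem_Icc.2 zero_le_one) zero_le_one
  simp only [zero_smul, add_zero, one_smul] at h01
  linarith

/-- Lower bound and nonnegativity of the augmented Lagrangian when
`Λ_n = −∇f_n(Φ) − L_n(Φ_n − Φ)`, `h ≥ 0`, `f_n ≥ 0` and `ρ_n ≥ 5L_n`. -/
theorem stmt_8 {E : Type*} [NormedAddCommGroup E] [InnerProductSpace ℝ E]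
    {ι : Type*} (T : Finset ι)
    (h : ℝ × E → ℝ) (hh : ∀ p, 0 ≤ h p)
    (f : ι → E → ℝ) (f' : ι → E → E)
    (hgrad : ∀ n ∈ T, ∀ x, HasFDerivAt (f n) (InnerProductSpace.toDualMap ℝ E (f' n x)) x)
    (Ln : ι → ℝ)
    (hLip : ∀ n ∈ T, ∀ x y, ‖f' n x - f' n y‖ ≤ Ln n * ‖x - y‖)
    (hfpos : ∀ n ∈ T, ∀ x, 0 ≤ f n x)
    (ρ : ι → ℝ) (hρ : ∀ n ∈ T, 5 * Ln n ≤ ρ n)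
    (α : ℝ) (Φ : E) (Φn Λn : ι → E)
    (hΛ : ∀ n ∈ T, Λn n = -f' n Φ - Ln n • (Φn n - Φ)) :
    h (α, Φ) + ∑ n ∈ T, (f n Φ + (ρ n - 5 * Ln n) / 2 * ‖Φn n - Φ‖ ^ 2) ≤
      h (α, Φ) + ∑ n ∈ T, (f n (Φn n) + ⟪Λn n, Φn n - Φ⟫ + ρ n / 2 * ‖Φn n - Φ‖ ^ 2) ∧
    0 ≤ h (α, Φ) + ∑ n ∈ T, (f n (Φn n) + ⟪Λn n, Φn n - Φ⟫ + ρ n / 2 * ‖Φn n - Φ‖ ^ 2) := by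
  have hterm : ∀ n ∈ T, f n Φ + (ρ n - 5 * Ln n) / 2 * ‖Φn n - Φ‖ ^ 2 ≤
      f n (Φn n) + ⟪Λn n, Φn n - Φ⟫ + ρ n / 2 * ‖Φn n - Φ‖ ^ 2 := fun n hn => by
    have hlow := sub_le_image_sub_of_lipschitz_gradient (hgrad n hn) (hLip n hn) Φ (Φn n - Φ)
    rw [add_sub_cancel] at hlow
    have hnonneg : 0 ≤ Ln n * ‖Φn n - Φ‖ * ‖Φn n - Φ‖ :=
      mul_nonneg ((norm_nonneg _).trans (hLip n hn (Φn n) Φ)) (norm_nonneg _)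
    rw [hΛ n hn, inner_sub_left, inner_neg_left, real_inner_smul_left,
      real_inner_self_eq_norm_sq]
    linarith
  have hle := add_le_add_right (Finset.sum_le_sum hterm) (h (α, Φ))
  refine ⟨hle, le_trans (add_nonneg (hh _) (Finset.sum_nonneg fun n hn => ?_)) hle⟩
  exact add_nonneg (hfpos n hn Φ)
    (mul_nonneg (by linarith [hρ n hn]) (sq_nonneg _))
end

section
/- Let f : E → ℝ be differentiable with L-Lipschitz gradient, let ρ > 0, and let Φ⁺, Λ, Φ_n ∈ E. Let Φ_n⁺ = Φ⁺ − (∇f(Φ⁺) + Λ)/(ρ + L), which is the unique minimizer over E of the surrogate U(x) = f(Φ⁺) + ⟨∇f(Φ⁺) + Λ, x − Φ⁺⟩ + ((ρ + L)/2)‖x − Φ⁺‖². Define L_blk(x) = f(x) + ⟨Λ, x − Φ⁺⟩ + (ρ/2)‖x − Φ⁺‖². Then L_blk(Φ_n) − L_blk(Φ_n⁺) ≥ −4L ‖Φ_n⁺ − Φ⁺‖² + ((ρ − 7L)/2) ‖Φ_n⁺ − Φ_n‖². -/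
open RealInnerProductSpace

/-- Along a segment, a function whose gradient is `L`-Lipschitz lies above its linearization with
slope taken at any third point `p`, up to an explicit error. -/
theorem inner_sub_le_sub_of_lipschitz_gradient {E : Type*} [NormedAddCommGroup E]
    [InnerProductSpace ℝ E] {f : E → ℝ} {f' : E → E}
    (hgrad : ∀ x, HasFDerivAt f (InnerProductSpace.toDualMap ℝ E (f' x)) x)
    {L : ℝ} (hL : 0 ≤ L) (hLip : ∀ x y, ‖f' x - f' y‖ ≤ L * ‖x - y‖) (p x y : E) :
    ⟪f' p, y - x⟫ - L * (‖x - p‖ + ‖y - x‖) * ‖y - x‖ ≤ f y - f x := by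
  obtain ⟨z, hz, hfz⟩ := domain_mvt (s := Set.univ)
    (fun w _ => (hgrad w).hasFDerivWithinAt) convex_univ (Set.mem_univ x) (Set.mem_univ y)
  rw [InnerProductSpace.toDualMap_apply_apply] at hfz
  have hzx : ‖z - x‖ ≤ ‖y - x‖ := norm_sub_le_of_mem_segment hz
  have hzp : ‖z - p‖ ≤ ‖x - p‖ + ‖y - x‖ := by
    linarith [norm_sub_le_norm_sub_add_norm_sub z x p]
  have hgz : ‖f' z - f' p‖ ≤ L * (‖x - p‖ + ‖y - x‖) :=
    (hLip z p).trans (mul_le_mul_of_nonneg_left hzp hL)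
  have hinner := neg_le_of_abs_le (abs_real_inner_le_norm (f' z - f' p) (y - x))
  have hmul := mul_le_mul_of_nonneg_right hgz (norm_nonneg (y - x))
  rw [inner_sub_left] at hinner
  linarith

/-- The quadratic model with linear term `-c • a` is, up to a constant, half of `c` times the
squared distance to `a`. -/
theorem inner_neg_smul_add_norm_sq {E : Type*} [NormedAddCommGroup E] [InnerProductSpace ℝ E]
    (c : ℝ) (a v : E) :
    ⟪-(c • a), v⟫ + c / 2 * ‖v‖ ^ 2 = c / 2 * ‖v - a‖ ^ 2 - c / 2 * ‖a‖ ^ 2 := by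
  rw [norm_sub_sq_real, inner_neg_left, real_inner_smul_left, real_inner_comm]
  ring

/-- For `f` with `L`-Lipschitz gradient and `ρ > 0`,
`Φ_n⁺ = Φ⁺ − (∇f(Φ⁺) + Λ)/(ρ + L)` is the unique minimizer over `E` of the
surrogate `U`, and the block Lagrangian satisfies
`L_blk(Φ_n) − L_blk(Φ_n⁺) ≥ −4L‖Φ_n⁺ − Φ⁺‖² + ((ρ − 7L)/2)‖Φ_n⁺ − Φ_n‖²`. -/
theorem stmt_11 {E : Type*} [NormedAddCommGroup E] [InnerProductSpace ℝ E]
    (f : E → ℝ) (f' : E → E)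
    (hgrad : ∀ x, HasFDerivAt f (InnerProductSpace.toDualMap ℝ E (f' x)) x)
    (L : ℝ) (hLip : ∀ x y, ‖f' x - f' y‖ ≤ L * ‖x - y‖)
    (ρ : ℝ) (hρ : 0 < ρ)
    (Φp Λ Φn Φnp : E)
    (hΦnp : Φnp = Φp - (ρ + L)⁻¹ • (f' Φp + Λ)) :
    (∀ x : E,
        f Φp + ⟪f' Φp + Λ, Φnp - Φp⟫ + (ρ + L) / 2 * ‖Φnp - Φp‖ ^ 2 ≤
          f Φp + ⟪f' Φp + Λ, x - Φp⟫ + (ρ + L) / 2 * ‖x - Φp‖ ^ 2) ∧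
    (∀ x : E,
        (∀ y : E,
            f Φp + ⟪f' Φp + Λ, x - Φp⟫ + (ρ + L) / 2 * ‖x - Φp‖ ^ 2 ≤
              f Φp + ⟪f' Φp + Λ, y - Φp⟫ + (ρ + L) / 2 * ‖y - Φp‖ ^ 2) →
          x = Φnp) ∧
    -(4 * L) * ‖Φnp - Φp‖ ^ 2 + (ρ - 7 * L) / 2 * ‖Φnp - Φn‖ ^ 2 ≤
      (f Φn + ⟪Λ, Φn - Φp⟫ + ρ / 2 * ‖Φn - Φp‖ ^ 2) -
        (f Φnp + ⟪Λ, Φnp - Φp⟫ + ρ / 2 * ‖Φnp - Φp‖ ^ 2) := by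
  rcases subsingleton_or_nontrivial E with _ | _
  · obtain rfl := Subsingleton.elim Φn Φp
    obtain rfl := Subsingleton.elim Φnp Φn
    refine ⟨fun x => ?_, fun x _ => Subsingleton.elim _ _, by simp⟩
    rw [Subsingleton.elim x Φnp]
  obtain ⟨u, v, huv⟩ := exists_pair_ne E
  have hL : 0 ≤ L := nonneg_of_mul_nonneg_left ((norm_nonneg _).trans (hLip u v))
    (norm_pos_iff.2 (sub_ne_zero.2 huv))
  have hc : 0 < ρ + L := by linarith
  have hg : f' Φp + Λ = -((ρ + L) • (Φnp - Φp)) := by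
    rw [hΦnp, sub_sub_cancel_left, smul_neg, smul_inv_smul₀ hc.ne', neg_neg]
  have hU (x : E) : f Φp + ⟪f' Φp + Λ, x - Φp⟫ + (ρ + L) / 2 * ‖x - Φp‖ ^ 2 =
      f Φp + ((ρ + L) / 2 * ‖x - Φnp‖ ^ 2 - (ρ + L) / 2 * ‖Φnp - Φp‖ ^ 2) := by
    rw [add_assoc, hg, inner_neg_smul_add_norm_sq, sub_sub_sub_cancel_right]
  refine ⟨fun x => ?_, fun x hx => ?_, ?_⟩
  · have := mul_nonneg (half_pos hc).le (sq_nonneg ‖x - Φnp‖)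
    rw [hU, hU, sub_self, norm_zero]
    linarith
  · have h := hx Φnp
    rw [hU, hU, sub_self, norm_zero] at h
    by_contra hne
    have := mul_pos (half_pos hc) (pow_pos (norm_pos_iff.2 (sub_ne_zero.2 hne)) 2)
    linarith
  · have hf := inner_sub_le_sub_of_lipschitz_gradient hgrad hL hLip Φp Φnp Φn
    have hlin : ⟪f' Φp, Φn - Φnp⟫ + ⟪Λ, Φn - Φnp⟫ =
        -((ρ + L) * ⟪Φnp - Φp, Φn - Φnp⟫) := by
      rw [← inner_add_left, hg, inner_neg_left, real_inner_smul_left]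
    have hsplit : Φn - Φp = (Φnp - Φp) + (Φn - Φnp) := by abel
    rw [hsplit, norm_add_sq_real, inner_add_right, norm_sub_rev Φnp Φn]
    have hcs := mul_le_mul_of_nonneg_left
      (real_inner_le_norm (Φnp - Φp) (Φn - Φnp)) hL
    have hsq := mul_nonneg hL (sq_nonneg (‖Φnp - Φp‖ - ‖Φn - Φnp‖))
    have ha := mul_nonneg hL (sq_nonneg ‖Φnp - Φp‖)
    have hb := mul_nonneg hL (sq_nonneg ‖Φn - Φnp‖)
    linarith
end

section
/- Let f : E → ℝ be differentiable with L-Lipschitz gradient, let ρ > 0, and let Φ, Φ⁺, Φ_n, Φ_n⁺ ∈ E. Suppose Λ = −∇f(Φ) − L(Φ_n − Φ), Λ⁺ = −∇f(Φ⁺) − L(Φ_n⁺ − Φ⁺), and Λ⁺ = Λ + ρ(Φ_n⁺ − Φ⁺). Then ⟨Λ − Λ⁺, Φ_n⁺ − Φ⁺⟩ = −(1/ρ)‖Λ⁺ − Λ‖² ≥ −(2L²/ρ)(2‖Φ_n⁺ − Φ_n‖² + 3‖Φ⁺ − Φ‖²). -/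
open RealInnerProductSpace

/-- With `Λ = −∇f(Φ) − L(Φ_n − Φ)`, `Λ⁺ = −∇f(Φ⁺) − L(Φ_n⁺ − Φ⁺)` and
`Λ⁺ = Λ + ρ(Φ_n⁺ − Φ⁺)` for `f` with `L`-Lipschitz gradient and `ρ > 0`,
`⟨Λ − Λ⁺, Φ_n⁺ − Φ⁺⟩ = −(1/ρ)‖Λ⁺ − Λ‖² ≥ −(2L²/ρ)(2‖Φ_n⁺ − Φ_n‖² + 3‖Φ⁺ − Φ‖²)`. -/
theorem stmt_12 {E : Type*} [NormedAddCommGroup E] [InnerProductSpace ℝ E]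
    (f : E → ℝ) (f' : E → E)
    (hgrad : ∀ x, HasFDerivAt f (InnerProductSpace.toDualMap ℝ E (f' x)) x)
    (L : ℝ) (hLip : ∀ x y, ‖f' x - f' y‖ ≤ L * ‖x - y‖)
    (ρ : ℝ) (hρ : 0 < ρ)
    (Φ Φp Φn Φnp Λ Λp : E)
    (hΛ : Λ = -f' Φ - L • (Φn - Φ))
    (hΛp : Λp = -f' Φp - L • (Φnp - Φp))
    (hup : Λp = Λ + ρ • (Φnp - Φp)) :
    ⟪Λ - Λp, Φnp - Φp⟫ = -(1 / ρ) * ‖Λp - Λ‖ ^ 2 ∧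
    -(2 * L ^ 2 / ρ) * (2 * ‖Φnp - Φn‖ ^ 2 + 3 * ‖Φp - Φ‖ ^ 2) ≤
      -(1 / ρ) * ‖Λp - Λ‖ ^ 2 := by
  have hdiff : Λp - Λ = ρ • (Φnp - Φp) := by rw [hup]; abel
  constructor
  · have hneg : Λ - Λp = -(ρ • (Φnp - Φp)) := by rw [← hdiff]; abel
    rw [hneg, hdiff, inner_neg_left, real_inner_smul_left, real_inner_self_eq_norm_sq,
      norm_smul, Real.norm_eq_abs, mul_pow, sq_abs]
    field_simp
  · have hsplit : Λp - Λ = -(f' Φp - f' Φ) - L • (Φnp - Φn) + L • (Φp - Φ) := by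
      rw [hΛ, hΛp]; module
    have hnorm : ‖Λp - Λ‖ ≤ |L| * (2 * ‖Φp - Φ‖ + ‖Φnp - Φn‖) := by
      have h₁ := norm_add_le (-(f' Φp - f' Φ) - L • (Φnp - Φn)) (L • (Φp - Φ))
      have h₂ := norm_sub_le (-(f' Φp - f' Φ)) (L • (Φnp - Φn))
      have h₃ := mul_le_mul_of_nonneg_right (le_abs_self L) (norm_nonneg (Φp - Φ))
      rw [← hsplit, norm_smul, Real.norm_eq_abs] at h₁
      rw [norm_neg, norm_smul, Real.norm_eq_abs] at h₂
      linarith [hLip Φp Φ]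
    have hsq : ‖Λp - Λ‖ ^ 2 ≤
        2 * L ^ 2 * (2 * ‖Φnp - Φn‖ ^ 2 + 3 * ‖Φp - Φ‖ ^ 2) := by
      calc ‖Λp - Λ‖ ^ 2 ≤ (|L| * (2 * ‖Φp - Φ‖ + ‖Φnp - Φn‖)) ^ 2 := by gcongr
        _ = L ^ 2 * (2 * ‖Φp - Φ‖ + ‖Φnp - Φn‖) ^ 2 := by rw [mul_pow, sq_abs]
        _ ≤ L ^ 2 * (2 * (2 * ‖Φnp - Φn‖ ^ 2 + 3 * ‖Φp - Φ‖ ^ 2)) := by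
          gcongr
          nlinarith [sq_nonneg (‖Φp - Φ‖ - ‖Φnp - Φn‖), sq_nonneg ‖Φnp - Φn‖]
        _ = _ := by ring
    have hdiv := mul_le_mul_of_nonneg_left hsq (one_div_pos.mpr hρ).le
    calc -(2 * L ^ 2 / ρ) * (2 * ‖Φnp - Φn‖ ^ 2 + 3 * ‖Φp - Φ‖ ^ 2)
        = -(1 / ρ * (2 * L ^ 2 * (2 * ‖Φnp - Φn‖ ^ 2 + 3 * ‖Φp - Φ‖ ^ 2))) := by ring
      _ ≤ -(1 / ρ) * ‖Λp - Λ‖ ^ 2 := by linarith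
end
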